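/- For f : ℂPⁿ → ℂPᵐ (1 ≤ n ≤ m) of nonzero degree, TC(f) = 2n. -/

import Mathlib

open ContinuousMap Set

/-- `U ⊆ B` is `f`-categorical for `p : E → B`: it is open and admits `s : U → E`
with `f ∘ p ∘ s` homotopic to `f|_U`. -/
def IsFCatOpen {E B X : Type} [TopologicalSpace E] [TopologicalSpace B] [TopologicalSpace X]
    (p : C(E, B)) (f : C(B, X)) (U : Set B) : Prop :=
  IsOpen U ∧ ∃ s : C(U, E), ((f.comp p).comp s).Homotopic (f.restrict U)

/-- The `f`-sectional category `secat_f(p)`: least `n` such that `B` is covered by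
`n+1` `f`-categorical open sets (`⊤` if none exists). -/
noncomputable def secatF {E B X : Type} [TopologicalSpace E] [TopologicalSpace B] [TopologicalSpace X]
    (p : C(E, B)) (f : C(B, X)) : ℕ∞ :=
  sInf ((↑) '' {n : ℕ | ∃ U : Fin (n + 1) → Set B,
    (∀ i, IsFCatOpen p f (U i)) ∧ ⋃ i, U i = univ})

/-- The (normalized) Lusternik–Schnirelmann category of a map: least `n` such that the
domain is covered by `n+1` open sets on each of which the map is null-homotopic. -/
noncomputable def catMap {B X : Type} [TopologicalSpace B] [TopologicalSpace X]
    (f : C(B, X)) : ℕ∞ :=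
  sInf ((↑) '' {n : ℕ | ∃ U : Fin (n + 1) → Set B,
    (∀ i, IsOpen (U i) ∧ (f.restrict (U i)).Nullhomotopic) ∧ ⋃ i, U i = univ})

/-- The path fibration `π : X^I → X × X`, `π(α) = (α 0, α 1)`. -/
noncomputable def pathFib (X : Type) [TopologicalSpace X] : C(C(unitInterval, X), X × X) :=
  ⟨fun α => (α 0, α 1), by fun_prop⟩

/-- The diagonal map `Δ : X → X × X`. -/
def diagMap (X : Type) [TopologicalSpace X] : C(X, X × X) := ⟨fun x => (x, x), by fun_prop⟩

/-- The topological complexity of a map, `TC(f) = secat_{f×f}(π)`. -/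
noncomputable def TCmap {X Y : Type} [TopologicalSpace X] [TopologicalSpace Y] (f : C(X, Y)) : ℕ∞ :=
  secatF (pathFib X) (f.prodMap f)

open scoped LinearAlgebra.Projectivization

/-- Complex projective `n`-space `ℂPⁿ`, with the quotient topology. -/
noncomputable instance CPtop (n : ℕ) :
    TopologicalSpace (ℙ ℂ (EuclideanSpace ℂ (Fin (n + 1)))) :=
  instTopologicalSpaceQuotient

section
open Finset

namespace TCP
/-- k-th skip -/
def skip (i j : ℕ) : ℕ := if j < i then j else j + 1

def cob {P : Type} (r : ℕ) (φ : (ℕ → P) → ℝ) (p : ℕ → P) : ℝ :=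
  ∑ i ∈ range (r + 2), (-1 : ℝ) ^ i * φ (p ∘ skip i)

def cup {P : Type} (r : ℕ) (φ ψ : (ℕ → P) → ℝ) (p : ℕ → P) : ℝ :=
  φ p * ψ (fun j => p (j + r))

def Dep {P : Type} (r : ℕ) (φ : (ℕ → P) → ℝ) : Prop :=
  ∀ p q : ℕ → P, (∀ j ≤ r, p j = q j) → φ p = φ q

theorem leibniz {P : Type} (r s : ℕ) (φ ψ : (ℕ → P) → ℝ) (hφ : Dep r φ) (p : ℕ → P) :
    cob (r + s) (cup r φ ψ) p = cup (r + 1) (cob r φ) ψ p + (-1) ^ r * cup r φ (cob s ψ) p := by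
  unfold cob cup
  have e : r + s + 2 = (r + 1) + (s + 1) := by ring
  rw [e, Finset.sum_range_add]
  beta_reduce
  rw [Finset.sum_range_succ _ (r + 1), add_mul, Finset.sum_mul]
  rw [Finset.sum_range_succ' _ (s + 1)]
  have h1 : ∀ i ∈ range (r + 1), (-1 : ℝ) ^ i * (φ (p ∘ skip i) * ψ fun j => (p ∘ skip i) (j + r))
      = (-1) ^ i * φ (p ∘ skip i) * ψ fun j => p (j + (r + 1)) := by
    intro i hi
    rw [Finset.mem_range] at hi
    have : (fun j => (p ∘ skip i) (j + r)) = fun j => p (j + (r + 1)) := by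
      funext j
      simp only [Function.comp, skip]
      rw [if_neg (by omega)]; rfl
    rw [this]; ring
  rw [Finset.sum_congr rfl h1]
  have h2 : ∀ i, r < i → φ (p ∘ skip i) = φ p := by
    intro i hi
    apply hφ
    intro j hj
    simp only [Function.comp, skip]
    rw [if_pos (by omega)]
  have h3 : ∀ i ∈ range (s + 1), (-1 : ℝ) ^ (r + 1 + i) *
      (φ (p ∘ skip (r + 1 + i)) * ψ fun j => (p ∘ skip (r + 1 + i)) (j + r))
      = (-1) ^ r * (φ p * ((-1) ^ (i + 1) * ψ ((fun j => p (j + r)) ∘ skip (i + 1)))) := by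
    intro i hi
    rw [h2 _ (by omega)]
    have : (fun j => (p ∘ skip (r + 1 + i)) (j + r)) = (fun j => p (j + r)) ∘ skip (i + 1) := by
      funext j
      simp only [Function.comp, skip]
      congr 1
      split_ifs <;> omega
    rw [this]; ring
  rw [Finset.sum_congr rfl h3, h2 (r + 1) (by omega)]
  have h4 : (fun j => p (j + r)) ∘ skip 0 = fun j => p (j + (r + 1)) := by
    funext j
    simp only [Function.comp, skip]
    rw [if_neg (by omega)]
    congr 1; ring
  rw [h4, ← Finset.mul_sum, ← Finset.mul_sum]
  ring

/-- simplex -/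
def kuhn {m : ℕ} (v : Fin m → ℤ) (σ : Equiv.Perm (Fin m)) (j : ℕ) : Fin m → ℤ :=
  v + ∑ i : Fin m, if (i : ℕ) < j then Pi.single (σ i) (1 : ℤ) else 0

def zv {m M : ℕ} (u : Fin m → ZMod M) : Fin m → ℤ := fun i => ((u i).val : ℤ)

theorem zshift {m M : ℕ} [NeZero M] (g : (Fin m → ℤ) → ℝ)
    (hg : ∀ v a, g (v + Pi.single a (M : ℤ)) = g v) (u : Fin m → ZMod M) (a : Fin m) :
    g (zv u + Pi.single a 1) = g (zv (u + Pi.single a 1)) := by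
  by_cases h : (u a).val + 1 < M
  · congr 1
    funext i
    by_cases hi : i = a
    · subst hi
      simp only [zv, Pi.add_apply, Pi.single_eq_same]
      have h1 : ((1 : ZMod M)).val = 1 := by
        have : Fact (1 < M) := ⟨by omega⟩
        exact ZMod.val_one M
      rw [ZMod.val_add_of_lt (by rw [h1]; exact h), h1]
      push_cast; rfl
    · simp [zv, Pi.add_apply, Pi.single_eq_of_ne hi]
  · have h2 : (u a).val + 1 = M := by
      have := ZMod.val_lt (u a); omega
    rw [← hg (zv (u + Pi.single a 1)) a]
    congr 1
    funext i
    by_cases hi : i = a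
    · subst hi
      simp only [zv, Pi.add_apply, Pi.single_eq_same]
      have : u i + 1 = 0 := by
        have h3 : (((u i).val + 1 : ℕ) : ZMod M) = 0 := by rw [h2]; simp
        simpa using h3
      rw [this, ZMod.val_zero]; push_cast [← h2]; ring
    · simp [zv, Pi.add_apply, Pi.single_eq_of_ne hi]

theorem zsum {m M : ℕ} [NeZero M] (g : (Fin m → ℤ) → ℝ)
    (hg : ∀ v a, g (v + Pi.single a (M : ℤ)) = g v) (a : Fin m) :
    ∑ u : Fin m → ZMod M, g (zv u + Pi.single a 1) = ∑ u : Fin m → ZMod M, g (zv u) := by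
  simp_rw [zshift g hg]
  exact Fintype.sum_equiv (Equiv.addRight (Pi.single a (1 : ZMod M))) _ _ (fun u => rfl)

def integ {m : ℕ} (M : ℕ) [NeZero M] (φ : (ℕ → (Fin m → ℤ)) → ℝ) : ℝ :=
  ∑ σ : Equiv.Perm (Fin m), ∑ u : Fin m → ZMod M,
    ((Equiv.Perm.sign σ : ℤ) : ℝ) * φ (kuhn (zv u) σ)

def Per {m : ℕ} (M : ℕ) (φ : (ℕ → (Fin m → ℤ)) → ℝ) : Prop :=
  ∀ p a, φ (fun j => p j + Pi.single a (M : ℤ)) = φ p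

theorem kuhn_swap {m : ℕ} (v : Fin m → ℤ) (σ : Equiv.Perm (Fin m)) (i : ℕ) (hi : i + 1 < m) :
    kuhn v (σ * Equiv.swap ⟨i, by omega⟩ ⟨i + 1, hi⟩) ∘ skip (i + 1) = kuhn v σ ∘ skip (i + 1) := by
  funext j
  simp only [Function.comp, kuhn]
  congr 1
  set t : Equiv.Perm (Fin m) := Equiv.swap ⟨i, by omega⟩ ⟨i + 1, hi⟩ with ht
  refine Fintype.sum_equiv t _ _ ?_
  intro k
  have : ((k : ℕ) < skip (i + 1) j) ↔ ((t k : ℕ) < skip (i + 1) j) := by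
    rw [ht, Equiv.swap_apply_def]
    split_ifs with h1 h2
    · subst h1; simp only [skip]; split_ifs <;> omega
    · subst h2; simp only [skip]; split_ifs <;> omega
    · rfl
  simp only [Equiv.Perm.mul_apply]
  simp only [this]

theorem stokes {n M : ℕ} [NeZero M] (β : (ℕ → (Fin (n + 1) → ℤ)) → ℝ) (hd : Dep n β)
    (hp : Per M β) : integ M (cob n β) = 0 := by
  unfold integ cob
  simp_rw [Finset.mul_sum]
  have e : ∀ T : Equiv.Perm (Fin (n + 1)) → (Fin (n + 1) → ZMod M) → ℕ → ℝ,
      (∑ σ, ∑ u, ∑ i ∈ range (n + 2), T σ u i) = ∑ i ∈ range (n + 2), ∑ σ, ∑ u, T σ u i := by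
    intro T
    rw [Finset.sum_comm]
    simp_rw [Finset.sum_comm (s := (univ : Finset (Equiv.Perm (Fin (n + 1))))) (t := range (n + 2))]
    rw [Finset.sum_comm]
    refine Finset.sum_congr rfl fun i _ => Finset.sum_comm
  rw [e, Finset.sum_range_succ, Finset.sum_range_succ']
  have hin : ∀ i ∈ range n, (∑ σ : Equiv.Perm (Fin (n + 1)), ∑ u : Fin (n + 1) → ZMod M,
      ((Equiv.Perm.sign σ : ℤ) : ℝ) * ((-1) ^ (i + 1) * β (kuhn (zv u) σ ∘ skip (i + 1)))) = 0 := by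
    intro i hi
    rw [Finset.mem_range] at hi
    set t : Equiv.Perm (Fin (n + 1)) := Equiv.swap ⟨i, by omega⟩ ⟨i + 1, by omega⟩ with ht
    have hs : Equiv.Perm.sign t = -1 := Equiv.Perm.sign_swap (by simp)
    have := Fintype.sum_equiv (Equiv.mulRight t)
      (fun σ : Equiv.Perm (Fin (n + 1)) => -∑ u : Fin (n + 1) → ZMod M,
      ((Equiv.Perm.sign σ : ℤ) : ℝ) * ((-1) ^ (i + 1) * β (kuhn (zv u) σ ∘ skip (i + 1))))
      (fun σ : Equiv.Perm (Fin (n + 1)) => ∑ u : Fin (n + 1) → ZMod M,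
      ((Equiv.Perm.sign σ : ℤ) : ℝ) * ((-1) ^ (i + 1) * β (kuhn (zv u) σ ∘ skip (i + 1)))) ?_
    · rw [Finset.sum_neg_distrib] at this
      linarith
    · intro σ
      rw [← Finset.sum_neg_distrib]
      refine Finset.sum_congr rfl fun u _ => ?_
      rw [Equiv.coe_mulRight, ht, kuhn_swap _ _ i (by omega), ← ht, Equiv.Perm.sign_mul, hs]
      push_cast; ring
  rw [Finset.sum_eq_zero hin, zero_add]
  have h0 : ∀ σ : Equiv.Perm (Fin (n + 1)), ∑ u : Fin (n + 1) → ZMod M, β (kuhn (zv u) σ ∘ skip 0)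
      = ∑ u : Fin (n + 1) → ZMod M, β (kuhn (zv u) (σ * finRotate (n + 1))) := by
    intro σ
    rw [← zsum (fun v => β (kuhn v (σ * finRotate (n + 1)))) _ (σ 0)]
    · refine Finset.sum_congr rfl fun u _ => hd _ _ ?_
      intro j hj
      have hsk : skip 0 j = j + 1 := by simp [skip]
      simp only [Function.comp, kuhn, hsk]
      rw [add_assoc]
      congr 1
      rw [Fin.sum_univ_succ, Fin.sum_univ_castSucc]
      rw [if_pos (show ((0 : Fin (n + 1)) : ℕ) < j + 1 by simp),
        if_neg (show ¬ ((Fin.last n : Fin (n + 1)) : ℕ) < j by simp; omega), add_zero]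
      congr 1
      refine Finset.sum_congr rfl fun k _ => ?_
      have : finRotate (n + 1) k.castSucc = k.succ := by simp
      rw [Equiv.Perm.mul_apply, this]
      simp
    · intro v a
      rw [← hp (kuhn v _) a]
      congr 1
      funext j
      simp only [kuhn]; abel
  have hl : ∀ σ : Equiv.Perm (Fin (n + 1)), ∀ u : Fin (n + 1) → ZMod M, β (kuhn (zv u) σ ∘ skip (n + 1)) = β (kuhn (zv u) σ) := by
    intro σ u
    apply hd
    intro j hj
    simp only [Function.comp, skip]
    rw [if_pos (by omega)]
  simp_rw [hl, ← Finset.mul_sum, h0, Finset.mul_sum]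
  have := Fintype.sum_equiv (Equiv.mulRight (finRotate (n + 1)))
      (fun σ : Equiv.Perm (Fin (n + 1)) => ∑ u : Fin (n + 1) → ZMod M,
      ((Equiv.Perm.sign σ : ℤ) : ℝ) * ((-1) ^ 0 * β (kuhn (zv u) (σ * finRotate (n + 1)))))
      (fun σ : Equiv.Perm (Fin (n + 1)) => -∑ u : Fin (n + 1) → ZMod M,
      ((Equiv.Perm.sign σ : ℤ) : ℝ) * ((-1) ^ (n + 1) * β (kuhn (zv u) σ))) ?_
  · rw [this, Finset.sum_neg_distrib]; ring
  · intro σ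
    rw [← Finset.sum_neg_distrib]
    refine Finset.sum_congr rfl fun u _ => ?_
    rw [Equiv.coe_mulRight, Equiv.Perm.sign_mul, sign_finRotate]
    push_cast
    rcases neg_one_pow_eq_or ℝ n with h | h <;> rw [pow_succ, h] <;> ring
end TCP
end

section
open Finset
namespace TCP

def w2 {P : Type} (A : P → P → ℝ) (p : ℕ → P) : ℝ := A (p 1) (p 2) - A (p 0) (p 2) + A (p 0) (p 1)

def W {P : Type} (A : ℕ → P → P → ℝ) (k : ℕ) (p : ℕ → P) : ℝ :=
  ∏ j ∈ range k, w2 (A j) (fun i => p (i + 2 * j))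

theorem cob_one {P : Type} (B : P → P → ℝ) : cob 1 (fun p : ℕ → P => B (p 0) (p 1)) = w2 B := by
  funext p
  simp [cob, w2, Finset.sum_range_succ, skip]
  ring

theorem cob_w2 {P : Type} (B : P → P → ℝ) (p : ℕ → P) : cob 2 (w2 B) p = 0 := by
  simp [cob, w2, Finset.sum_range_succ, skip]
  ring

theorem dep_w2 {P : Type} (B : P → P → ℝ) : Dep 2 (w2 B) := by
  intro p q h
  simp only [w2]
  rw [h 0 (by norm_num), h 1 (by norm_num), h 2 (by norm_num)]

theorem W_succ {P : Type} (A : ℕ → P → P → ℝ) (k : ℕ) :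
    W A (k + 1) = cup (2 * k) (W A k) (w2 (A k)) := by
  funext p
  simp [W, cup, Finset.prod_range_succ]

theorem dep_W {P : Type} (A : ℕ → P → P → ℝ) (k : ℕ) : Dep (2 * k) (W A k) := by
  intro p q h
  refine Finset.prod_congr rfl fun j hj => dep_w2 _ _ _ ?_
  intro i hi
  rw [Finset.mem_range] at hj
  exact h _ (by omega)

theorem cob_W {P : Type} (A : ℕ → P → P → ℝ) (k : ℕ) (p : ℕ → P) : cob (2 * k) (W A k) p = 0 := by
  induction k generalizing p with
  | zero => simp [cob, W, Finset.sum_range_succ]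
  | succ k ih =>
    rw [W_succ, show 2 * (k + 1) = 2 * k + 2 by ring, leibniz _ _ _ _ (dep_W A k)]
    simp [cup, ih, cob_w2]

theorem W_split {P : Type} (A : ℕ → P → P → ℝ) (k l : ℕ) (p : ℕ → P) :
    W A (k + 1 + l) p = cup (2 * k) (W A k) (cup 2 (w2 (A k)) (W (fun j => A (k + 1 + j)) l)) p := by
  simp only [W, cup, Finset.prod_range_add, Finset.prod_range_succ, mul_assoc]
  congr 2
  refine Finset.prod_congr rfl fun j _ => ?_
  congr 1
  funext i
  congr 1
  ring

theorem w2_per {m M : ℕ} {B : (Fin m → ℤ) → (Fin m → ℤ) → ℝ}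
    (hB : ∀ p q a, B (p + Pi.single a (M : ℤ)) (q + Pi.single a (M : ℤ)) = B p q) : Per M (w2 B) := by
  intro p a
  simp only [w2, hB]

theorem W_per {m M : ℕ} {A : ℕ → (Fin m → ℤ) → (Fin m → ℤ) → ℝ}
    (hB : ∀ j, Per M (w2 (A j))) (k : ℕ) : Per M (W A k) := by
  intro p a
  refine Finset.prod_congr rfl fun j _ => ?_
  exact hB j (fun i => p (i + 2 * j)) a

theorem step {m M : ℕ} [NeZero M] (A A' : ℕ → (Fin m → ℤ) → (Fin m → ℤ) → ℝ) (k l : ℕ)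
    (hm : m = 2 * (k + 1 + l)) (hA : ∀ j, Per M (w2 (A j)))
    (hB : ∀ p q a, (A k - A' k) (p + Pi.single a (M : ℤ)) (q + Pi.single a (M : ℤ)) = (A k - A' k) p q)
    (hne : ∀ j, j ≠ k → A j = A' j) :
    integ M (W A (k + 1 + l)) = integ M (W A' (k + 1 + l)) := by
  obtain ⟨n, rfl⟩ : ∃ n, m = n + 1 := ⟨2 * k + (1 + 2 * l), by omega⟩
  have hn : n = 2 * k + (1 + 2 * l) := by omega
  set b : (ℕ → (Fin (n + 1) → ℤ)) → ℝ := fun p => (A k - A' k) (p 0) (p 1) with hb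
  set Y := W (fun j => A (k + 1 + j)) l with hY
  have hbd : Dep 1 b := by
    intro p q h
    simp only [hb]
    rw [h 0 (by norm_num), h 1 (by norm_num)]
  have key : ∀ p, W A (k + 1 + l) p = W A' (k + 1 + l) p
      + cob n (cup (2 * k) (W A k) (cup 1 b Y)) p := by
    intro p
    have hc : cob n (cup (2 * k) (W A k) (cup 1 b Y)) p
        = cob (2 * k + (1 + 2 * l)) (cup (2 * k) (W A k) (cup 1 b Y)) p := congrArg (fun t => cob t _ p) hn
    rw [hc, leibniz _ _ _ _ (dep_W A k), W_split, W_split]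
    have e1 : (fun j => A' (k + 1 + j)) = fun j => A (k + 1 + j) := by
      funext j; rw [hne _ (by omega)]
    have e2 : W A' k = W A k := by
      funext p
      refine Finset.prod_congr rfl fun j hj => ?_
      rw [Finset.mem_range] at hj
      rw [hne _ (by omega)]
    rw [e1, e2, ← hY]
    simp only [cup, cob_W, leibniz _ _ _ _ hbd]
    rw [hY, cob_W, hb, cob_one]
    simp only [w2, Pi.sub_apply, pow_mul]
    ring
  have h2 : integ M (cob n (cup (2 * k) (W A k) (cup 1 b Y))) = 0 := by
    apply stokes
    · intro p q h
      simp only [cup]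
      rw [dep_W A k p q (fun j hj => h j (by omega)), hbd _ (fun j => q (j + 2 * k)) (fun j hj => h _ (by omega)),
        hY, dep_W _ l _ (fun j => q (j + 1 + 2 * k)) (fun j hj => h _ (by omega))]
    · intro p a
      simp only [cup]
      rw [W_per hA]
      have h3 : Per M b := fun p a => hB _ _ _
      have h4 : Per M Y := W_per (fun j => hA _) _
      rw [h3 (fun j => p (j + 2 * k)) a, h4 (fun j => p (j + 1 + 2 * k)) a]
  have h3 : integ M (W A (k + 1 + l)) = integ M (W A' (k + 1 + l))
      + integ M (cob n (cup (2 * k) (W A k) (cup 1 b Y))) := by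
    simp only [integ, key, mul_add, Finset.sum_add_distrib]
  rw [h3, h2, add_zero]

theorem hybrid {m M : ℕ} [NeZero M] (N : ℕ) (hm : m = 2 * N)
    (A : ℕ → (Fin m → ℤ) → (Fin m → ℤ) → ℝ) (A0 : (Fin m → ℤ) → (Fin m → ℤ) → ℝ)
    (h0 : Per M (w2 A0))
    (hB : ∀ j p q a, (A j - A0) (p + Pi.single a (M : ℤ)) (q + Pi.single a (M : ℤ)) = (A j - A0) p q) :
    integ M (W A N) = integ M (W (fun _ => A0) N) := by
  have hA : ∀ j, Per M (w2 (A j)) := by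
    intro j p a
    have h1 := w2_per (hB j) p a
    have h2 := h0 p a
    simp only [w2, Pi.sub_apply] at h1 h2 ⊢
    linarith
  have key : ∀ k ≤ N, integ M (W A N) = integ M (W (fun j => if j < k then A0 else A j) N) := by
    intro k
    induction k with
    | zero => intro _; simp
    | succ k ih =>
      intro hk
      rw [ih (by omega)]
      obtain ⟨l, rfl⟩ : ∃ l, N = k + 1 + l := ⟨N - (k + 1), by omega⟩
      apply step _ _ _ _ hm
      · intro j
        split_ifs
        · exact h0
        · exact hA j
      · intro p q a
        simpa using hB k p q a
      · intro j hj
        have : j < k ↔ j < k + 1 := by omega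
        simp [this]
  rw [key N le_rfl]
  congr 1
  funext p
  refine Finset.prod_congr rfl fun j hj => ?_
  rw [Finset.mem_range] at hj
  simp [hj]

def ev {N : ℕ} (k : Fin N) : Fin (N * 2) := finProdFinEquiv (k, 0)
def od {N : ℕ} (k : Fin N) : Fin (N * 2) := finProdFinEquiv (k, 1)

def A0 {N : ℕ} (c : ℝ) (p q : Fin (N * 2) → ℤ) : ℝ :=
  c * ∑ k : Fin N, (p (ev k) : ℝ) * ((q (od k) : ℝ) - p (od k))

theorem w2_A0 {N : ℕ} (c : ℝ) (p : ℕ → (Fin (N * 2) → ℤ)) :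
    w2 (A0 c) p = c * ∑ k : Fin N, ((p 1 (ev k) : ℝ) - p 0 (ev k)) * ((p 2 (od k) : ℝ) - p 1 (od k)) := by
  simp only [w2, A0]
  rw [← mul_sub, ← mul_add, ← Finset.sum_sub_distrib, ← Finset.sum_add_distrib]
  congr 1
  refine Finset.sum_congr rfl fun k _ => ?_
  ring

theorem per_A0 {N : ℕ} (c : ℝ) (M : ℕ) : Per M (w2 (A0 (N := N) c)) := by
  intro p a
  rw [w2_A0, w2_A0]
  simp

theorem kuhn_succ {m : ℕ} (v : Fin m → ℤ) (σ : Equiv.Perm (Fin m)) (i : Fin m) :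
    kuhn v σ (i + 1) = kuhn v σ i + Pi.single (σ i) 1 := by
  simp only [kuhn, add_assoc]
  congr 1
  have : (Pi.single (σ i) 1 : Fin m → ℤ) = ∑ k : Fin m, if k = i then Pi.single (σ k) (1 : ℤ) else 0 := by
    simp
  rw [this, ← Finset.sum_add_distrib]
  refine Finset.sum_congr rfl fun k _ => ?_
  by_cases h1 : k = i
  · subst h1; simp
  · have : (k : ℕ) ≠ i := fun h => h1 (Fin.ext h)
    have h2 : ((k : ℕ) < i + 1) ↔ ((k : ℕ) < i) := by omega
    simp [h1, h2]

def ind {N : ℕ} (σ : Equiv.Perm (Fin (N * 2))) (j : Fin N) : ℝ :=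
  ∑ k : Fin N, (if σ (ev j) = ev k then 1 else 0) * (if σ (od j) = od k then 1 else 0)

theorem ind_nonneg {N : ℕ} (σ : Equiv.Perm (Fin (N * 2))) (j : Fin N) : 0 ≤ ind σ j := by
  refine Finset.sum_nonneg fun k _ => ?_
  split_ifs <;> norm_num

theorem W_A0 {N : ℕ} (c : ℝ) (v : Fin (N * 2) → ℤ) (σ : Equiv.Perm (Fin (N * 2))) :
    W (fun _ => A0 (N := N) c) N (kuhn v σ) = c ^ N * ∏ j : Fin N, ind σ j := by
  rw [W, Finset.prod_range]
  have : ∀ j : Fin N, w2 (A0 (N := N) c) (fun i => kuhn v σ (i + 2 * (j : ℕ))) = c * ind σ j := by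
    intro j
    rw [w2_A0]
    congr 1
    refine Finset.sum_congr rfl fun k _ => ?_
    have e0 : 0 + 2 * (j : ℕ) = (ev j : Fin (N * 2)) := by simp [ev]
    have e1 : 1 + 2 * (j : ℕ) = (ev j : Fin (N * 2)) + 1 := by simp [ev]; ring
    have e1' : 1 + 2 * (j : ℕ) = (od j : Fin (N * 2)) := by simp [od]
    have e2 : 2 + 2 * (j : ℕ) = (od j : Fin (N * 2)) + 1 := by simp [od]; ring
    congr 1
    · rw [e1, e0, kuhn_succ]
      simp [Pi.single_apply, eq_comm]
    · rw [e2, e1', kuhn_succ]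
      simp [Pi.single_apply, eq_comm]
  simp_rw [this, Finset.prod_mul_distrib]
  simp

theorem sign_of_ind {N : ℕ} (σ : Equiv.Perm (Fin (N * 2))) (h : ∏ j : Fin N, ind σ j ≠ 0) :
    Equiv.Perm.sign σ = 1 := by
  have h1 : ∀ j : Fin N, ∃ k, σ (ev j) = ev k ∧ σ (od j) = od k := by
    intro j
    have := Finset.prod_ne_zero_iff.1 h j (Finset.mem_univ _)
    obtain ⟨k, _, hk⟩ := Finset.exists_ne_zero_of_sum_ne_zero this
    refine ⟨k, ?_⟩
    by_contra hc
    rw [not_and_or] at hc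
    rcases hc with hc | hc <;> simp [hc] at hk
  choose τ hτ using h1
  have hinj : Function.Injective τ := by
    intro a b hab
    have : σ (ev a) = σ (ev b) := by rw [(hτ a).1, (hτ b).1, hab]
    have := finProdFinEquiv.injective (σ.injective this)
    simpa using this
  let t : Equiv.Perm (Fin N) := Equiv.ofBijective τ (Finite.injective_iff_bijective.1 hinj)
  have : σ = finProdFinEquiv.permCongr (Equiv.prodCongrLeft (fun _ : Fin 2 => t)) := by
    ext i
    obtain ⟨⟨j, b⟩, rfl⟩ := finProdFinEquiv.surjective i
    rw [Equiv.permCongr_apply, Equiv.symm_apply_apply]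
    have hb : b = 0 ∨ b = 1 := by fin_cases b <;> simp
    rcases hb with rfl | rfl
    · exact congrArg Fin.val (hτ j).1
    · exact congrArg Fin.val (hτ j).2
  rw [this, Equiv.Perm.sign_permCongr, Equiv.Perm.sign_prodCongrLeft]
  simp only [Finset.prod_const, Finset.card_univ, Fintype.card_fin]
  exact Int.units_sq _

theorem integ_A0 {N M : ℕ} [NeZero M] (c : ℝ) (hc : c ≠ 0) :
    integ M (W (fun _ => A0 (N := N) c) N) ≠ 0 := by
  unfold integ
  have h1 : ∀ σ : Equiv.Perm (Fin (N * 2)), ((Equiv.Perm.sign σ : ℤ) : ℝ) * ∏ j : Fin N, ind σ j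
      = ∏ j : Fin N, ind σ j := by
    intro σ
    by_cases h : ∏ j : Fin N, ind σ j = 0
    · rw [h, mul_zero]
    · rw [sign_of_ind σ h]; simp
  have h2 : ∀ (σ : Equiv.Perm (Fin (N * 2))) (u : Fin (N * 2) → ZMod M), ((Equiv.Perm.sign σ : ℤ) : ℝ) *
      W (fun _ => A0 (N := N) c) N (kuhn (zv u) σ) = c ^ N * ∏ j : Fin N, ind σ j := by
    intro σ u
    rw [W_A0, mul_left_comm, h1]
  simp_rw [h2, ← Finset.mul_sum]
  refine mul_ne_zero (pow_ne_zero _ hc) (ne_of_gt ?_)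
  refine Finset.sum_pos' (fun σ _ => Finset.sum_nonneg fun u _ => Finset.prod_nonneg fun j _ => ind_nonneg σ j)
    ⟨1, Finset.mem_univ _, ?_⟩
  have : ∀ j : Fin N, 0 < ind (1 : Equiv.Perm (Fin (N * 2))) j := by
    intro j
    refine Finset.sum_pos' (fun k _ => ?_) ⟨j, Finset.mem_univ _, by simp⟩
    split_ifs <;> norm_num
  exact Finset.sum_pos (fun u _ => Finset.prod_pos fun j _ => this j) ⟨0, Finset.mem_univ _⟩

end TCP
end

section
open Finset
namespace TCP

noncomputable def bb (g h : ℂ) (a : ℝ) : ℝ :=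
  Complex.arg (h * (starRingEnd ℂ) g * Complex.exp (-(2 * Real.pi * a * Complex.I))) / (2 * Real.pi)

theorem bb_exp (g h : ℂ) (a : ℝ) (hg : g ≠ 0) (hh : h ≠ 0) :
    Complex.exp (2 * Real.pi * (a + bb g h a : ℝ) * Complex.I) = h * (starRingEnd ℂ) g / (‖h‖ * ‖g‖) := by
  set z := h * (starRingEnd ℂ) g * Complex.exp (-(2 * Real.pi * a * Complex.I)) with hz
  have hpi : (Real.pi : ℂ) ≠ 0 := by exact_mod_cast Real.pi_ne_zero
  have e : (2 * Real.pi * (a + bb g h a : ℝ) * Complex.I : ℂ)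
      = 2 * Real.pi * a * Complex.I + Complex.arg z * Complex.I := by
    simp only [bb, ← hz]
    push_cast
    field_simp
  have hn : ‖z‖ = ‖h‖ * ‖g‖ := by
    rw [hz, norm_mul, norm_mul, RCLike.norm_conj]
    have : ‖Complex.exp (-(2 * Real.pi * a * Complex.I))‖ = 1 := by
      rw [show (-(2 * Real.pi * a * Complex.I) : ℂ) = ((-(2 * Real.pi * a) : ℝ) : ℂ) * Complex.I by push_cast; ring]
      exact Complex.norm_exp_ofReal_mul_I _
    rw [this, mul_one]
  have h1 := Complex.norm_mul_exp_arg_mul_I z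
  rw [hn] at h1
  have h2 : Complex.exp (Complex.arg z * Complex.I) = z / (‖h‖ * ‖g‖) := by
    rw [eq_div_iff (by simp [hg, hh])]
    push_cast at h1
    linear_combination h1
  rw [e, Complex.exp_add, h2, hz, Complex.exp_neg]
  have := Complex.exp_ne_zero (2 * Real.pi * a * Complex.I)
  field_simp

theorem bb_small (g h : ℂ) (a : ℝ) (hg : g ≠ 0) (hgh : ‖h - g‖ ≤ ‖g‖ / 2) (ha : |a| ≤ 1 / 100) :
    |a + bb g h a| < 1 / 3 := by
  have hgp : 0 < ‖g‖ := norm_pos_iff.2 hg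
  set e := Complex.exp (-(2 * Real.pi * a * Complex.I)) with he
  have he1 : ‖e - 1‖ ≤ 1 / 10 := by
    have h3 : (-(2 * Real.pi * a * Complex.I) : ℂ) = Complex.I * ((-(2 * Real.pi * a) : ℝ) : ℂ) := by push_cast; ring
    have h1 := Real.norm_exp_I_mul_ofReal_sub_one_le (x := -(2 * Real.pi * a))
    rw [he, h3]
    refine h1.trans ?_
    rw [norm_neg, Real.norm_eq_abs, abs_mul, abs_mul, abs_of_pos Real.pi_pos, abs_of_pos (by norm_num : (0 : ℝ) < 2)]
    have := Real.pi_lt_d2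
    have := Real.pi_pos
    nlinarith [abs_nonneg a]
  have hen : ‖e‖ = 1 := by
    rw [he, show (-(2 * Real.pi * a * Complex.I) : ℂ) = ((-(2 * Real.pi * a) : ℝ) : ℂ) * Complex.I by push_cast; ring]
    exact Complex.norm_exp_ofReal_mul_I _
  have h2 : ‖h * e - g‖ < ‖g‖ := by
    have : h * e - g = (h - g) * e + g * (e - 1) := by ring
    rw [this]
    refine (norm_add_le _ _).trans_lt ?_
    rw [norm_mul, norm_mul, hen]
    nlinarith
  have h3 : 0 < (h * (starRingEnd ℂ) g * e).re := by
    have h4 : h * (starRingEnd ℂ) g * e = (h * e - g) * (starRingEnd ℂ) g + (‖g‖ ^ 2 : ℝ) := by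
      have := Complex.mul_conj' g
      push_cast
      rw [← this]; ring
    rw [h4, Complex.add_re, Complex.ofReal_re]
    have h5 := Complex.abs_re_le_norm ((h * e - g) * (starRingEnd ℂ) g)
    rw [norm_mul, RCLike.norm_conj] at h5
    have h6 := neg_abs_le ((h * e - g) * (starRingEnd ℂ) g).re
    nlinarith
  have h4 := Complex.abs_arg_lt_pi_div_two_iff.2 (Or.inl h3)
  have h5 : |bb g h a| < 1 / 4 := by
    simp only [bb, ← he]
    rw [abs_div, abs_of_pos (by positivity : 0 < 2 * Real.pi), div_lt_iff₀ (by positivity)]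
    linarith
  have := abs_add_le a (bb g h a)
  linarith

theorem bb_cocycle (g0 g1 g2 : ℂ) (a01 a02 a12 : ℝ) (h0 : g0 ≠ 0) (h1 : g1 ≠ 0) (h2 : g2 ≠ 0)
    (h01 : |a01 + bb g0 g1 a01| < 1 / 3) (h02 : |a02 + bb g0 g2 a02| < 1 / 3)
    (h12 : |a12 + bb g1 g2 a12| < 1 / 3) :
    (a12 + bb g1 g2 a12) - (a02 + bb g0 g2 a02) + (a01 + bb g0 g1 a01) = 0 := by
  have e01 := bb_exp g0 g1 a01 h0 h1
  have e02 := bb_exp g0 g2 a02 h0 h2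
  have e12 := bb_exp g1 g2 a12 h1 h2
  set x := a01 + bb g0 g1 a01
  set y := a02 + bb g0 g2 a02
  set z := a12 + bb g1 g2 a12
  have key : Complex.exp (2 * Real.pi * (z - y + x : ℝ) * Complex.I) = 1 := by
    have : (2 * Real.pi * (z - y + x : ℝ) * Complex.I : ℂ) = (2 * Real.pi * z * Complex.I)
      + (2 * Real.pi * x * Complex.I) - (2 * Real.pi * y * Complex.I) := by push_cast; ring
    rw [this, Complex.exp_sub, Complex.exp_add, e01, e02, e12]
    have n0 : (‖g0‖ : ℂ) ≠ 0 := by simpa using h0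
    have n1 : (‖g1‖ : ℂ) ≠ 0 := by simpa using h1
    have n2 : (‖g2‖ : ℂ) ≠ 0 := by simpa using h2
    have c0 : (starRingEnd ℂ) g0 ≠ 0 := by simpa using h0
    have := Complex.mul_conj' g1
    field_simp
    rw [mul_comm, this]
  rw [Complex.exp_eq_one_iff] at key
  obtain ⟨n, hn⟩ := key
  have hpi : (Real.pi : ℂ) ≠ 0 := by exact_mod_cast Real.pi_ne_zero
  have h3 : ((z - y + x : ℝ) : ℂ) = (n : ℝ) := by
    have hI := Complex.I_ne_zero
    have : (2 * Real.pi * Complex.I : ℂ) ≠ 0 := by simp [Real.pi_ne_zero]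
    apply mul_left_cancel₀ this
    push_cast at hn ⊢
    linear_combination hn
  have h4 : z - y + x = (n : ℝ) := by exact_mod_cast h3
  have h5 : |(n : ℝ)| < 1 := by
    rw [← h4]
    rw [abs_lt] at *
    constructor <;> linarith [h01.1, h01.2, h02.1, h02.2, h12.1, h12.2]
  have : n = 0 := by
    have : |n| < 1 := by exact_mod_cast h5
    exact Int.abs_lt_one_iff.1 this
  rw [h4, this]; simp

theorem ev_ne_od {N : ℕ} (k l : Fin N) : ev k ≠ od l := by
  intro h
  have := finProdFinEquiv.injective h
  simp at this

theorem ev_inj {N : ℕ} {k l : Fin N} (h : ev k = ev l) : k = l := by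
  have := finProdFinEquiv.injective h
  simpa using this

theorem ev_or_od {N : ℕ} (a : Fin (N * 2)) : (∃ k, a = ev k) ∨ ∃ k, a = od k := by
  obtain ⟨⟨j, b⟩, rfl⟩ := finProdFinEquiv.surjective a
  have hb : b = 0 ∨ b = 1 := by fin_cases b <;> simp
  rcases hb with rfl | rfl
  · exact Or.inl ⟨j, rfl⟩
  · exact Or.inr ⟨j, rfl⟩

noncomputable def rr {m : ℕ} (M : ℕ) (p : Fin m → ℤ) : Fin m → ℝ := fun i => (p i : ℝ) / M

theorem rr_shift {m : ℕ} (M : ℕ) [NeZero M] (p : Fin m → ℤ) (a : Fin m) :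
    rr M (p + Pi.single a (M : ℤ)) = rr M p + Pi.single a 1 := by
  have : (M : ℝ) ≠ 0 := by exact_mod_cast NeZero.ne M
  funext i
  by_cases h : i = a
  · subst h; simp [rr, add_div, this]
  · simp [rr, Pi.single_eq_of_ne h]

theorem kuhn_mem {m M : ℕ} [NeZero M] (u : Fin m → ZMod M) (σ : Equiv.Perm (Fin m)) (j : ℕ) (i : Fin m) :
    zv u i ≤ kuhn (zv u) σ j i ∧ kuhn (zv u) σ j i ≤ zv u i + 1 := by
  have : kuhn (zv u) σ j i = zv u i + if ((σ.symm i : Fin m) : ℕ) < j then 1 else 0 := by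
    simp only [kuhn, Pi.add_apply, Finset.sum_apply]
    congr 1
    rw [Finset.sum_eq_single (σ.symm i)]
    · split_ifs <;> simp
    · intro b _ hb
      have : i ≠ σ b := by rintro rfl; simp at hb
      split_ifs <;> simp [Pi.single_eq_of_ne this]
    · simp
  rw [this]
  split_ifs <;> simp

theorem torus_key (N : ℕ) (d : ℤ) (hd : d ≠ 0) (F : (Fin (N * 2) → ℝ) → Fin N → ℂ) (hF : Continuous F)
    (hne : ∀ p, ∃ i, F p i ≠ 0)
    (hx : ∀ p k i, F (p + Pi.single (ev k) 1) i
      = Complex.exp (2 * Real.pi * (d * p (od k) : ℝ) * Complex.I) * F p i)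
    (hy : ∀ p k i, F (p + Pi.single (od k) 1) i = F p i) : False := by
  have hK : IsCompact (Set.Icc (0 : Fin (N * 2) → ℝ) 1) := isCompact_Icc
  obtain ⟨p0, hp0, hmin⟩ := hK.exists_isMinOn ⟨0, by simp⟩ (f := fun p => ‖F p‖) (by fun_prop)
  set δ := ‖F p0‖ with hδ
  have hδ0 : 0 < δ := by
    obtain ⟨i, hi⟩ := hne p0
    exact lt_of_lt_of_le (norm_pos_iff.2 hi) (norm_le_pi_norm _ i)
  have huc := hK.uniformContinuousOn_of_continuous hF.continuousOn
  rw [Metric.uniformContinuousOn_iff] at huc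
  obtain ⟨η, hη, huc⟩ := huc (δ / 8) (by positivity)
  obtain ⟨M0, hM0⟩ := exists_nat_gt (max (1 / η) (100 * (|(d : ℝ)| * N)))
  have hMpos : (0 : ℝ) < M0 := lt_of_le_of_lt (by positivity) ((le_max_left _ _).trans_lt hM0)
  have hM1 : 1 / (M0 : ℝ) < η := by
    rw [div_lt_iff₀ hMpos]
    have := (le_max_left _ _).trans_lt hM0
    rw [div_lt_iff₀ hη] at this
    linarith
  have hM2 : |(d : ℝ)| * N / M0 ≤ 1 / 100 := by
    rw [div_le_iff₀ hMpos]
    have := (le_max_right _ _).trans_lt hM0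
    linarith
  have : NeZero M0 := ⟨by rintro rfl; simp at hMpos⟩
  set c : ℝ := d / (M0 : ℝ) ^ 2 with hc
  have hc0 : c ≠ 0 := by
    have : (d : ℝ) ≠ 0 := by exact_mod_cast hd
    positivity
  set G : (Fin (N * 2) → ℤ) → Fin N → ℂ := fun p => F (rr M0 p) with hG
  set A : ℕ → (Fin (N * 2) → ℤ) → (Fin (N * 2) → ℤ) → ℝ := fun j p q =>
    A0 (N := N) c p q + if h : j < N then bb (G p ⟨j, h⟩) (G q ⟨j, h⟩) (A0 (N := N) c p q) else 0 with hA
  have hper : integ M0 (W A N) = integ M0 (W (fun _ => A0 (N := N) c) N) := by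
    apply hybrid N (by ring) A _ (per_A0 c M0)
    intro j p q a
    simp only [hA, Pi.sub_apply, add_sub_cancel_left]
    split_ifs with hj
    · simp only [hG, rr_shift]
      rcases ev_or_od a with ⟨k, rfl⟩ | ⟨k, rfl⟩
      · rw [hx, hx]
        have e1 : A0 c (p + Pi.single (ev k) (M0 : ℤ)) (q + Pi.single (ev k) (M0 : ℤ))
            = A0 c p q + d * (rr M0 q (od k) - rr M0 p (od k)) := by
          simp only [A0]
          have : ∀ l : Fin N, (((p + Pi.single (ev k) (M0 : ℤ) : Fin (N * 2) → ℤ) (ev l) : ℤ) : ℝ) *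
              ((((q + Pi.single (ev k) (M0 : ℤ) : Fin (N * 2) → ℤ) (od l) : ℤ) : ℝ) - ((p + Pi.single (ev k) (M0 : ℤ) : Fin (N * 2) → ℤ) (od l) : ℤ))
              = (p (ev l) : ℝ) * ((q (od l) : ℝ) - p (od l))
              + if l = k then (M0 : ℝ) * ((q (od l) : ℝ) - p (od l)) else 0 := by
            intro l
            have h1 : od l ≠ ev k := fun h => ev_ne_od _ _ h.symm
            by_cases hl : l = k
            · subst hl
              simp [Pi.single_eq_of_ne h1]; ring
            · have h2 : ev l ≠ ev k := fun h => hl (ev_inj h)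
              simp [Pi.single_eq_of_ne h1, Pi.single_eq_of_ne h2, hl]
          simp_rw [this, Finset.sum_add_distrib]
          rw [Finset.sum_ite_eq' univ k, if_pos (Finset.mem_univ _), mul_add]
          congr 1
          simp only [rr, hc]
          field_simp
        rw [e1]
        simp only [bb]
        congr 2
        rw [map_mul, ← Complex.exp_conj]
        simp only [map_mul, Complex.conj_I, Complex.conj_ofReal, map_ofNat]
        have e2 : (-(2 * Real.pi * ((A0 c p q : ℝ) : ℂ) * Complex.I))
            = (2 * Real.pi * (d * rr M0 q (od k) : ℝ) * Complex.I)
            + (2 * Real.pi * (d * rr M0 p (od k) : ℝ) * -Complex.I)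
            + (-(2 * Real.pi * ((A0 c p q + d * (rr M0 q (od k) - rr M0 p (od k)) : ℝ) : ℂ) * Complex.I)) := by
          push_cast; ring
        rw [e2, Complex.exp_add, Complex.exp_add]
        ring
      · rw [hy, hy]
        have e1 : A0 c (p + Pi.single (od k) (M0 : ℤ)) (q + Pi.single (od k) (M0 : ℤ)) = A0 c p q := by
          simp only [A0]
          congr 1
          refine Finset.sum_congr rfl fun l _ => ?_
          simp [Pi.single_eq_of_ne (ev_ne_od l k)]
        rw [e1]
    · rfl
  have hzero : integ M0 (W A N) = 0 := by
    unfold integ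
    refine Finset.sum_eq_zero fun σ _ => Finset.sum_eq_zero fun u _ => ?_
    refine mul_eq_zero_of_right _ ?_
    set P := kuhn (zv u) σ with hP
    have hb : ∀ j i, 0 ≤ rr M0 (P j) i ∧ rr M0 (P j) i ≤ 1 := by
      intro j i
      have h1 := kuhn_mem u σ j i
      have h2 : (0 : ℤ) ≤ zv u i := by simp only [zv]; positivity
      have h3 : zv u i + 1 ≤ (M0 : ℤ) := by
        have := ZMod.val_lt (u i)
        simp only [zv]; omega
      simp only [rr]
      constructor
      · apply div_nonneg _ hMpos.le
        exact_mod_cast h2.trans h1.1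
      · rw [div_le_one hMpos]
        exact_mod_cast h1.2.trans h3
    have hmem : ∀ j, rr M0 (P j) ∈ Set.Icc (0 : Fin (N * 2) → ℝ) 1 :=
      fun j => ⟨fun i => (hb j i).1, fun i => (hb j i).2⟩
    have hdiff : ∀ j l i, |rr M0 (P j) i - rr M0 (P l) i| ≤ 1 / M0 := by
      intro j l i
      have h1 := kuhn_mem u σ j i
      have h2 := kuhn_mem u σ l i
      simp only [rr]
      rw [← sub_div, abs_div, abs_of_pos hMpos]
      apply div_le_div_of_nonneg_right _ hMpos.le
      have : |P j i - P l i| ≤ 1 := by simp only [hP]; rw [abs_le]; constructor <;> omega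
      exact_mod_cast this
    have hdist : ∀ j l, dist (rr M0 (P j)) (rr M0 (P l)) < η := by
      intro j l
      refine lt_of_le_of_lt ((dist_pi_le_iff (by positivity)).2 fun i => ?_) hM1
      rw [Real.dist_eq]; exact hdiff j l i
    have hA0 : ∀ j l, |A0 (N := N) c (P j) (P l)| ≤ 1 / 100 := by
      intro j l
      refine le_trans ?_ hM2
      have : A0 (N := N) c (P j) (P l) = d * ∑ k : Fin N, rr M0 (P j) (ev k) * (rr M0 (P l) (od k) - rr M0 (P j) (od k)) := by
        simp only [A0, rr, hc]
        rw [Finset.mul_sum, Finset.mul_sum]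
        refine Finset.sum_congr rfl fun k _ => ?_
        field_simp
      rw [this, abs_mul, mul_div_assoc]
      apply mul_le_mul_of_nonneg_left _ (abs_nonneg _)
      refine (Finset.abs_sum_le_sum_abs _ _).trans ?_
      have : ∀ k ∈ (univ : Finset (Fin N)), |rr M0 (P j) (ev k) * (rr M0 (P l) (od k) - rr M0 (P j) (od k))| ≤ 1 / M0 := by
        intro k _
        rw [abs_mul]
        calc _ ≤ 1 * (1 / (M0 : ℝ)) := by
              apply mul_le_mul _ (hdiff _ _ _) (abs_nonneg _) zero_le_one
              rw [abs_of_nonneg (hb _ _).1]; exact (hb _ _).2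
          _ = _ := one_mul _
      refine (Finset.sum_le_card_nsmul _ _ _ this).trans ?_
      simp [div_eq_mul_inv]
    obtain ⟨i, hi⟩ : ∃ i, δ ≤ ‖F (rr M0 (P 0)) i‖ := by
      by_contra hcon
      push Not at hcon
      have h1 := hmin (hmem 0)
      simp only [Set.mem_setOf_eq] at h1
      have h2 := (pi_norm_lt_iff hδ0).2 hcon
      linarith
    have hclose : ∀ j l, ‖G (P j) i - G (P l) i‖ ≤ δ / 8 := by
      intro j l
      have := huc _ (hmem j) _ (hmem l) (hdist j l)
      rw [dist_eq_norm] at this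
      exact (norm_le_pi_norm (F (rr M0 (P j)) - F (rr M0 (P l))) i).trans this.le
    have hbig : ∀ j, 7 * δ / 8 ≤ ‖G (P j) i‖ := by
      intro j
      have h1 := hclose 0 j
      have h2 := norm_le_norm_add_norm_sub' (G (P 0) i) (G (P j) i)
      have h3 : δ ≤ ‖G (P 0) i‖ := hi
      linarith
    have hnz : ∀ j, G (P j) i ≠ 0 := by
      intro j h
      have := hbig j
      rw [h, norm_zero] at this
      linarith
    have hs : ∀ j l, |A0 (N := N) c (P j) (P l) + bb (G (P j) i) (G (P l) i) (A0 (N := N) c (P j) (P l))| < 1 / 3 := by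
      intro j l
      apply bb_small _ _ _ (hnz j) _ (hA0 j l)
      have := hclose l j
      have := hbig j
      linarith
    refine Finset.prod_eq_zero (i := (i : ℕ)) (Finset.mem_range.2 i.2) ?_
    simp only [w2, hA, dif_pos i.2, Fin.eta]
    exact bb_cocycle _ _ _ _ _ _ (hnz _) (hnz _) (hnz _) (hs _ _) (hs _ _) (hs _ _)
  rw [hzero] at hper
  exact integ_A0 c hc0 hper.symm

end TCP
end

section
open scoped LinearAlgebra.Projectivization
namespace TCP

abbrev V (n : ℕ) := EuclideanSpace ℂ (Fin (n + 1))
abbrev CP (n : ℕ) := ℙ ℂ (V n)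

noncomputable def pr {n : ℕ} (x : CP n) : V n →L[ℂ] V n := x.submodule.starProjection

theorem pr_idem {n : ℕ} (x : CP n) (v : V n) : pr x (pr x v) = pr x v := by
  rw [pr, Submodule.starProjection_eq_self_iff]
  exact Submodule.starProjection_apply_mem _ _

theorem sp_congr {n : ℕ} (S T : Submodule ℂ (V n)) (h : S = T) : S.starProjection = T.starProjection := by
  subst h; rfl

theorem pr_eq_self {n : ℕ} (x : CP n) (v : V n) : pr x v = v ↔ v ∈ x.submodule := by
  simp [pr, Submodule.starProjection_eq_self_iff]

theorem pr_mk {n : ℕ} (v : V n) (hv : v ≠ 0) :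
    pr (Projectivization.mk ℂ v hv) = ((‖v‖ ^ 2 : ℝ) : ℂ)⁻¹ • InnerProductSpace.rankOne ℂ v v := by
  ext1 w
  rw [pr, sp_congr _ _ (Projectivization.submodule_mk v hv), Submodule.starProjection_singleton]
  simp [smul_smul, div_eq_inv_mul]

theorem mk_eq_of_pr {n : ℕ} (x : CP n) (v : V n) (hv : v ≠ 0) (h : pr x v = v) :
    Projectivization.mk ℂ v hv = x := by
  rw [pr_eq_self] at h
  induction x using Projectivization.ind with
  | h u hu =>
    rw [Projectivization.submodule_mk, Submodule.mem_span_singleton] at h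
    obtain ⟨a, ha⟩ := h
    rw [Projectivization.mk_eq_mk_iff']
    exact ⟨a, ha⟩

theorem pr_mk_self {n : ℕ} (v : V n) (hv : v ≠ 0) : pr (Projectivization.mk ℂ v hv) v = v := by
  rw [pr_eq_self, Projectivization.submodule_mk]
  exact Submodule.mem_span_singleton_self v

theorem isQuotientMap_mk (n : ℕ) :
    IsOpenQuotientMap (fun v : {v : V n // v ≠ 0} => (Projectivization.mk ℂ v.1 v.2 : CP n)) := by
  refine ⟨Quotient.mk_surjective, continuous_quotient_mk', ?_⟩
  intro U hU
  have : IsOpen ((fun v : {v : V n // v ≠ 0} => (Projectivization.mk ℂ v.1 v.2 : CP n)) ⁻¹'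
      ((fun v : {v : V n // v ≠ 0} => (Projectivization.mk ℂ v.1 v.2 : CP n)) '' U)) := by
    have e : ((fun v : {v : V n // v ≠ 0} => (Projectivization.mk ℂ v.1 v.2 : CP n)) ⁻¹'
      ((fun v : {v : V n // v ≠ 0} => (Projectivization.mk ℂ v.1 v.2 : CP n)) '' U))
      = ⋃ a : ℂˣ, (fun v : {v : V n // v ≠ 0} => (⟨a • v.1, (smul_ne_zero_iff_ne a).2 v.2⟩ : {v : V n // v ≠ 0})) ⁻¹' U := by
      ext v
      simp only [Set.mem_preimage, Set.mem_image, Set.mem_iUnion, Projectivization.mk_eq_mk_iff]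
      constructor
      · rintro ⟨u, hu, a, ha⟩
        refine ⟨a, ?_⟩
        convert hu
      · rintro ⟨a, ha⟩
        exact ⟨_, ha, a, rfl⟩
    rw [e]
    refine isOpen_iUnion fun a => hU.preimage ?_
    refine Continuous.subtype_mk ?_ _
    exact continuous_subtype_val.const_smul a
  exact this

theorem continuous_mk {n : ℕ} {X : Type} [TopologicalSpace X] (v : X → V n) (hv : Continuous v) (h : ∀ x, v x ≠ 0) :
    Continuous (fun x => (Projectivization.mk ℂ (v x) (h x) : CP n)) :=
  (isQuotientMap_mk n).continuous.comp (hv.subtype_mk h)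

theorem continuous_pr (n : ℕ) : Continuous (pr : CP n → _) := by
  rw [(isQuotientMap_mk n).isQuotientMap.continuous_iff]
  have : pr ∘ (fun v : {v : V n // v ≠ 0} => (Projectivization.mk ℂ v.1 v.2 : CP n))
    = fun v : {v : V n // v ≠ 0} => ((‖v.1‖ ^ 2 : ℝ) : ℂ)⁻¹ • InnerProductSpace.rankOne ℂ v.1 v.1 := by
    funext v; exact pr_mk v.1 v.2
  rw [this]
  refine Continuous.fun_smul ?_ ?_
  · apply Continuous.inv₀
    · fun_prop
    · intro v
      have := norm_ne_zero_iff.2 v.2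
      exact_mod_cast pow_ne_zero 2 this
  · rw [continuous_clm_apply]
    intro y
    simp only [InnerProductSpace.rankOne_apply]
    fun_prop

theorem unif_curry {K Y : Type} [TopologicalSpace K] [CompactSpace K] [PseudoMetricSpace Y]
    (Q : C(unitInterval × K, Y)) (e : ℝ) (he : 0 < e) : ∃ η > 0, ∀ s t, dist s t < η →
      ∀ k, dist (Q (s, k)) (Q (t, k)) < e := by
  have huc := CompactSpace.uniformContinuous_of_continuous Q.curry.continuous
  rw [Metric.uniformContinuous_iff] at huc
  obtain ⟨η, hη, huc⟩ := huc e he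
  refine ⟨η, hη, fun s t h k => ?_⟩
  exact (ContinuousMap.dist_apply_le_dist (f := Q.curry s) (g := Q.curry t) k).trans_lt (huc h)

theorem transport {E K : Type} [NormedAddCommGroup E] [NormedSpace ℂ E] [TopologicalSpace K] [CompactSpace K]
    (Q : C(unitInterval × K, E →L[ℂ] E)) (hQ : ∀ p v, Q p (Q p v) = Q p v)
    (v0 : C(K, E)) (h0 : ∀ k, ‖v0 k‖ = 1) (h0Q : ∀ k, Q (0, k) (v0 k) = v0 k) :
    ∃ v1 : C(K, E), (∀ k, ‖v1 k‖ = 1) ∧ (∀ k, Q (1, k) (v1 k) = v1 k) ∧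
      ∀ k k' (l : ℂ), ‖l‖ = 1 → (∀ t, Q (t, k) = Q (t, k')) → v0 k' = l • v0 k → v1 k' = l • v1 k := by
  obtain ⟨η, hη, huc⟩ := unif_curry Q 1 one_pos
  obtain ⟨M, hM⟩ := exists_nat_one_div_lt hη
  have key : ∀ i : ℕ, i ≤ M + 1 → ∀ t : unitInterval, (t : ℝ) = i / ((M : ℝ) + 1) →
    ∃ v1 : C(K, E), (∀ k, ‖v1 k‖ = 1) ∧ (∀ k, Q (t, k) (v1 k) = v1 k) ∧
      ∀ k k' (l : ℂ), ‖l‖ = 1 → (∀ t, Q (t, k) = Q (t, k')) → v0 k' = l • v0 k → v1 k' = l • v1 k := by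
    intro i
    induction i with
    | zero =>
      intro _ t ht
      have : t = 0 := by ext; simpa using ht
      subst this
      exact ⟨v0, h0, h0Q, fun k k' l _ _ h => h⟩
    | succ i ih =>
      intro hi t ht
      have hs : (i : ℝ) / (M + 1) ∈ unitInterval := by
        constructor
        · positivity
        · rw [div_le_one (by positivity)]
          have : i ≤ M + 1 := by omega
          exact_mod_cast this
      obtain ⟨v, hv, hvQ, hve⟩ := ih (by omega) ⟨_, hs⟩ rfl
      have hd : ∀ k, dist (Q (t, k)) (Q (⟨_, hs⟩, k)) < 1 := by
        apply huc
        rw [Subtype.dist_eq, ht, Real.dist_eq]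
        refine lt_of_le_of_lt (le_of_eq ?_) hM
        push_cast
        rw [← sub_div, add_sub_cancel_left, abs_of_nonneg (by positivity)]
      have hne : ∀ k, Q (t, k) (v k) ≠ 0 := by
        intro k h
        have h1 := hd k
        rw [dist_eq_norm] at h1
        have h2 := (Q (t, k) - Q (⟨_, hs⟩, k)).le_opNorm (v k)
        simp only [_root_.sub_apply, h, hvQ, hv, zero_sub, norm_neg, mul_one] at h1 h2
        linarith
      have hc : Continuous fun k => Q (t, k) (v k) := by
        have : Continuous fun k => Q (t, k) := Q.continuous.comp (by fun_prop)
        exact this.clm_apply v.continuous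
      refine ⟨⟨fun k => (((‖Q (t, k) (v k)‖⁻¹ : ℝ)) : ℂ) • Q (t, k) (v k), ?_⟩, ?_, ?_, ?_⟩
      · refine Continuous.fun_smul ?_ hc
        exact Complex.continuous_ofReal.comp (hc.norm.inv₀ fun k => norm_ne_zero_iff.2 (hne k))
      · intro k
        have := norm_ne_zero_iff.2 (hne k)
        simp [norm_smul, this]
      · intro k
        simp only [ContinuousMap.coe_mk, map_smul, hQ]
      · intro k k' l hl hQQ hv0
        have := hve k k' l hl hQQ hv0
        simp only [ContinuousMap.coe_mk]
        rw [this, ← hQQ t, map_smul, norm_smul, hl, one_mul, smul_comm]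
  exact key (M + 1) le_rfl 1 (by push_cast; rw [div_self]; positivity)

end TCP
end

section
namespace TCP

theorem cocycle_triv {X : Type} [TopologicalSpace X] [PreconnectedSpace X] [Nonempty X]
    (R : ℝ → X → X) (hRc : Continuous fun p : ℝ × X => R p.1 p.2)
    (hR2 : ∀ x, R (2 * Real.pi) x = x)
    (c : ℝ → X → Circle) (hc : Continuous fun p : ℝ × X => c p.1 p.2)
    (hcc : ∀ s t x, c (s + t) x = c s (R t x) * c t x) (hc2 : ∀ x, c (2 * Real.pi) x = 1) :
    ∃ (d : ℤ) (k : C(X, ℝ)), ∀ t ∈ Set.Icc 0 (2 * Real.pi), ∀ x,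
      c t x = Circle.exp (k x - k (R t x) + d * t) := by
  have hpi := Real.pi_pos
  have hc0 : ∀ x, c 0 x = 1 := by
    intro x
    have h1 := hcc 0 (2 * Real.pi) x
    rw [hR2, zero_add, hc2, mul_one] at h1
    exact h1.symm
  let H : C(unitInterval × X, Circle) := ⟨fun p => c (4 * Real.pi * p.1) p.2, by
    exact hc.comp (by fun_prop : Continuous fun p : unitInterval × X => ((4 * Real.pi * (p.1 : ℝ), p.2) : ℝ × X))⟩
  let f0 : C(X, ℝ) := ⟨fun _ => 0, continuous_const⟩
  have H0 : ∀ x, H (0, x) = Circle.exp (f0 x) := by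
    intro x; simp [H, f0, hc0]
  obtain ⟨L, hL, hL0⟩ : ∃ L : C(unitInterval × X, ℝ), (∀ p, Circle.exp (L p) = H p) ∧ ∀ x, L (0, x) = 0 :=
    ⟨Circle.isCoveringMap_exp.liftHomotopy H f0 H0,
      fun p => congr_fun (Circle.isCoveringMap_exp.liftHomotopy_lifts H f0 H0) p,
      fun x => Circle.isCoveringMap_exp.liftHomotopy_zero H f0 H0 x⟩
  let η : ℝ → X → ℝ := fun t x => L (Set.projIcc 0 1 zero_le_one (t / (4 * Real.pi)), x)
  have hηc : Continuous fun p : ℝ × X => η p.1 p.2 := by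
    refine L.continuous.comp ?_
    refine Continuous.prodMk ?_ continuous_snd
    exact continuous_projIcc.comp (by fun_prop)
  have hη0 : ∀ x, η 0 x = 0 := by
    intro x; simp only [η, zero_div, Set.projIcc_left]; exact hL0 x
  have hη : ∀ t ∈ Set.Icc 0 (4 * Real.pi), ∀ x, Circle.exp (η t x) = c t x := by
    intro t ht x
    simp only [η, hL, H, ContinuousMap.coe_mk]
    have : t / (4 * Real.pi) ∈ Set.Icc (0 : ℝ) 1 :=
      ⟨div_nonneg ht.1 (by positivity), (div_le_one (by positivity)).2 ht.2⟩
    rw [Set.projIcc_of_mem _ this]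
    congr 1
    field_simp
  clear_value η
  have hadd : ∀ s ∈ Set.Icc 0 (2 * Real.pi), ∀ t ∈ Set.Icc 0 (2 * Real.pi), ∀ x,
      η (s + t) x = η s (R t x) + η t x := by
    intro s hs t ht x
    have c1 : Continuous fun s : ℝ => η (s + t) x :=
      hηc.comp (by fun_prop : Continuous fun s : ℝ => ((s + t, x) : ℝ × X))
    have c2 : Continuous fun s : ℝ => η s (R t x) :=
      hηc.comp (by fun_prop : Continuous fun s : ℝ => ((s, R t x) : ℝ × X))
    refine Circle.isCoveringMap_exp.eqOn_of_comp_eqOn (s := Set.Icc 0 (2 * Real.pi)) (g₁ := fun s => η (s + t) x)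
      (g₂ := fun s => η s (R t x) + η t x) isPreconnected_Icc
      c1.continuousOn (c2.add continuous_const).continuousOn ?_ (a := 0) ⟨le_rfl, by positivity⟩ ?_ hs
    · intro u hu
      simp only [Function.comp, Circle.exp_add]
      rw [hη _ ⟨by linarith [hu.1, ht.1], by linarith [hu.2, ht.2]⟩, hη _ ⟨hu.1, by linarith [hu.2]⟩,
        hη _ ⟨ht.1, by linarith [ht.2]⟩, hcc]
    · simp [hη0]
  obtain ⟨x0⟩ := ‹Nonempty X›
  obtain ⟨d, hd⟩ : ∃ d : ℤ, η (2 * Real.pi) x0 = d * (2 * Real.pi) := by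
    rw [← Circle.exp_eq_one, hη _ ⟨by positivity, by linarith⟩, hc2]
  have hd' : ∀ x, η (2 * Real.pi) x = d * (2 * Real.pi) := by
    intro x
    rw [← hd]
    refine Circle.isCoveringMap_exp.const_of_comp (g := fun x => η (2 * Real.pi) x) ?_ ?_ x x0
    · exact hηc.comp (by fun_prop : Continuous fun x : X => ((2 * Real.pi, x) : ℝ × X))
    · intro a a'
      rw [hη _ ⟨by positivity, by linarith⟩, hη _ ⟨by positivity, by linarith⟩, hc2, hc2]
  have hcx : ∀ x, Continuous fun s => η s x - d * s := fun x =>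
    (hηc.comp (by fun_prop : Continuous fun s : ℝ => ((s, x) : ℝ × X))).sub (by fun_prop)
  refine ⟨d, ⟨fun x => (2 * Real.pi)⁻¹ * ∫ s in (0 : ℝ)..(2 * Real.pi), (η s x - d * s), ?_⟩, ?_⟩
  · refine continuous_const.mul ?_
    apply intervalIntegral.continuous_parametric_intervalIntegral_of_continuous'
    exact (hηc.comp continuous_swap).sub (by fun_prop)
  · intro t ht x
    rw [← hη t ⟨ht.1, by linarith [ht.2]⟩]
    congr 1
    simp only [ContinuousMap.coe_mk]
    have e1 : ∫ s in (0 : ℝ)..(2 * Real.pi), (η s (R t x) - d * s)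
        = ∫ s in (0 : ℝ)..(2 * Real.pi), ((η (s + t) x - d * (s + t)) + (d * t - η t x)) := by
      apply intervalIntegral.integral_congr
      intro s hs
      rw [Set.uIcc_of_le (by positivity)] at hs
      simp only
      rw [hadd s hs t ht]; ring
    have hi : ∀ a b, IntervalIntegrable (fun s => η s x - d * s) MeasureTheory.volume a b :=
      fun a b => (hcx x).intervalIntegrable a b
    have hi' : IntervalIntegrable (fun s => η (s + t) x - d * (s + t)) MeasureTheory.volume 0 (2 * Real.pi) :=
      ((hcx x).comp (by fun_prop : Continuous fun s : ℝ => s + t)).intervalIntegrable _ _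
    have e2 : ∫ s in (0 : ℝ)..(2 * Real.pi), (η (s + t) x - d * (s + t))
        = ∫ s in (0 : ℝ)..(2 * Real.pi), (η s x - d * s) := by
      rw [intervalIntegral.integral_comp_add_right (fun s => η s x - d * s) t]
      rw [zero_add, add_comm (2 * Real.pi) t]
      have e3 : ∫ s in (0 : ℝ)..t, (η s x - d * s) = ∫ s in (2 * Real.pi)..(t + 2 * Real.pi), (η s x - d * s) := by
        have := intervalIntegral.integral_comp_add_right (a := 0) (b := t) (fun s => η s x - d * s) (2 * Real.pi)
        rw [zero_add] at this
        rw [← this]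
        apply intervalIntegral.integral_congr
        intro s hs
        rw [Set.uIcc_of_le ht.1] at hs
        simp only
        rw [hadd s ⟨hs.1, hs.2.trans ht.2⟩ (2 * Real.pi) ⟨by positivity, le_rfl⟩, hR2, hd']; ring
      rw [← intervalIntegral.integral_add_adjacent_intervals (hi t (2 * Real.pi)) (hi _ _), ← e3,
        ← intervalIntegral.integral_add_adjacent_intervals (hi 0 t) (hi _ (2 * Real.pi))]
      ring
    rw [e1, intervalIntegral.integral_add hi' (by simp), e2]
    simp only [intervalIntegral.integral_const, smul_eq_mul]
    field_simp
    ring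

end TCP
end

section
open scoped LinearAlgebra.Projectivization
namespace TCP

abbrev S (n : ℕ) := Metric.sphere (0 : V n) 1

theorem S_ne {n : ℕ} (z : S n) : z.1 ≠ 0 := by
  intro h
  have := z.2
  rw [h] at this
  simp at this

noncomputable def smk {n : ℕ} (z : S n) : CP n := Projectivization.mk ℂ z.1 (S_ne z)

theorem continuous_smk (n : ℕ) : Continuous (smk : S n → CP n) :=
  continuous_mk _ continuous_subtype_val _

theorem smk_eq {n : ℕ} (z w : S n) (l : ℂ) (h : w.1 = l • z.1) : smk w = smk z := by
  rw [smk, smk, Projectivization.mk_eq_mk_iff']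
  exact ⟨l, h.symm⟩

theorem line_unit {n : ℕ} (x : CP n) (u v : V n) (hu : ‖u‖ = 1) (hv : ‖v‖ = 1)
    (hxu : pr x u = u) (hxv : pr x v = v) : v = (inner ℂ u v : ℂ) • u ∧ ‖(inner ℂ u v : ℂ)‖ = 1 := by
  have hu0 : u ≠ 0 := by rintro rfl; simp at hu
  have h1 : v = (inner ℂ u v : ℂ) • u := by
    rw [← mk_eq_of_pr x u hu0 hxu, pr_mk] at hxv
    simp [hu] at hxv
    exact hxv.symm
  refine ⟨h1, ?_⟩
  have h2 := congrArg norm h1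
  rw [norm_smul, hu, hv, mul_one] at h2
  exact h2.symm

theorem circle_exp_Icc (l : ℂ) (hl : ‖l‖ = 1) : ∃ t ∈ Set.Icc 0 (2 * Real.pi), ((Circle.exp t : Circle) : ℂ) = l := by
  have h := Complex.norm_mul_exp_arg_mul_I l
  rw [hl, Complex.ofReal_one, one_mul] at h
  have hp := Real.pi_pos
  by_cases h0 : 0 ≤ l.arg
  · exact ⟨l.arg, ⟨h0, by linarith [Complex.arg_le_pi l]⟩, h⟩
  · refine ⟨l.arg + 2 * Real.pi, ⟨by linarith [Complex.neg_pi_lt_arg l], by linarith⟩, ?_⟩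
    rw [Circle.exp_add_two_pi]; exact h

abbrev Dd (n : ℕ) := {z : V n // ‖z‖ = 1 ∧ 0 ≤ (z 0).re ∧ (z 0).im = 0}
abbrev Bb (n : ℕ) := {z : V n // ‖z‖ = 1 ∧ z 0 = 0}

instance (n : ℕ) : CompactSpace (Dd n) := by
  apply isCompact_iff_compactSpace.1
  refine (isCompact_sphere (0 : V n) 1).of_isClosed_subset ?_ ?_
  · have h1 : IsClosed {z : V n | ‖z‖ = 1} := isClosed_eq (by fun_prop) (by fun_prop)
    have h2 : IsClosed {z : V n | 0 ≤ (z 0).re} := isClosed_le (by fun_prop) (by fun_prop)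
    have h3 : IsClosed {z : V n | (z 0).im = 0} := isClosed_eq (by fun_prop) (by fun_prop)
    exact h1.inter (h2.inter h3)
  · intro z hz
    simpa using hz.1

def bd {n : ℕ} (z : Bb n) : Dd n := ⟨z.1, z.2.1, by rw [z.2.2]; simp⟩

noncomputable def cons0 (n : ℕ) (w : EuclideanSpace ℂ (Fin n)) : V n := WithLp.toLp 2 (Fin.cons 0 w : Fin (n + 1) → ℂ)

theorem cons0_norm (n : ℕ) (w : EuclideanSpace ℂ (Fin n)) : ‖cons0 n w‖ = ‖w‖ := by
  rw [EuclideanSpace.norm_eq, EuclideanSpace.norm_eq, Fin.sum_univ_succ]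
  simp [cons0]

theorem Bb_pre (n : ℕ) (hn : 1 ≤ n) : PreconnectedSpace (Bb n) ∧ Nonempty (Bb n) := by
  have hc : Continuous (cons0 n) := by
    unfold cons0
    apply (PiLp.continuous_toLp 2 _).comp
    apply continuous_pi
    intro i
    refine Fin.cases ?_ (fun j => ?_) i
    · simpa using continuous_const
    · simp only [Fin.cons_succ]; fun_prop
  have hr : 1 < Module.rank ℝ (EuclideanSpace ℂ (Fin n)) := by
    have h1 : Module.finrank ℝ (EuclideanSpace ℂ (Fin n)) = 2 * n := by
      rw [← Module.finrank_mul_finrank ℝ ℂ]; simp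
    rw [← Module.finrank_eq_rank, h1]
    have : 1 < 2 * n := by omega
    exact_mod_cast this
  have hcon := isConnected_sphere hr (0 : EuclideanSpace ℂ (Fin n)) (zero_le_one)
  have e : {z : V n | ‖z‖ = 1 ∧ z 0 = 0} = cons0 n '' Metric.sphere 0 1 := by
    ext z
    constructor
    · rintro ⟨h1, h2⟩
      have : cons0 n (WithLp.toLp 2 (fun j => z j.succ)) = z := by
        ext i
        refine Fin.cases ?_ (fun j => ?_) i
        · simp [cons0, h2]
        · simp [cons0]
      refine ⟨_, ?_, this⟩
      rw [mem_sphere_zero_iff_norm, ← cons0_norm, this, h1]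
    · rintro ⟨w, hw, rfl⟩
      refine ⟨by rw [cons0_norm]; simpa using hw, by simp [cons0]⟩
  have h := hcon.image (cons0 n) hc.continuousOn
  rw [← e] at h
  exact ⟨isPreconnected_iff_preconnectedSpace.1 h.2, h.1.to_subtype⟩

noncomputable def Dpath {n : ℕ} (p : unitInterval × Dd n) : V n :=
  (((1 - (p.1 : ℝ) : ℝ) : ℂ)) • EuclideanSpace.single 0 1 + (((p.1 : ℝ)) : ℂ) • p.2.1

theorem Dpath_ne {n : ℕ} (p : unitInterval × Dd n) : Dpath p ≠ 0 := by
  intro h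
  obtain ⟨t, z, hz1, hz2, hz3⟩ := p
  have h0 := congrArg Complex.re (congrFun (congrArg WithLp.ofLp h) 0)
  simp only [Dpath, PiLp.add_apply, PiLp.smul_apply, EuclideanSpace.single_apply, if_true, smul_eq_mul, mul_one,
    Complex.add_re, Complex.ofReal_re, Complex.re_ofReal_mul, PiLp.zero_apply, Complex.zero_re] at h0
  have h1 := t.2.1
  have h2 := t.2.2
  have h3 := mul_nonneg h1 hz2
  have ht : (t : ℝ) = 1 := by linarith
  simp only [Dpath, ht, sub_self, Complex.ofReal_zero, zero_smul, zero_add, Complex.ofReal_one, one_smul] at h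
  rw [h] at hz1
  simp at hz1

theorem Dd_ne {n : ℕ} (z : Dd n) : z.1 ≠ 0 := by
  intro h
  have := z.2.1
  rw [h] at this
  simp at this

theorem lift_D {n m : ℕ} (f : C(CP n, CP m)) : ∃ g : C(Dd n, V m), (∀ z, ‖g z‖ = 1) ∧
    ∀ z, pr (f (Projectivization.mk ℂ z.1 (Dd_ne z))) (g z) = g z := by
  let Q : C(unitInterval × Dd n, V m →L[ℂ] V m) :=
    ⟨fun p => pr (f (Projectivization.mk ℂ (Dpath p) (Dpath_ne p))), by
      refine (continuous_pr m).comp (f.continuous.comp ?_)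
      apply continuous_mk
      unfold Dpath
      fun_prop⟩
  obtain ⟨u, hu, hu'⟩ : ∃ u : V m, ‖u‖ = 1 ∧ ∀ k, Q (0, k) u = u := by
    have hs : (EuclideanSpace.single 0 1 : V n) ≠ 0 := by simp
    set x := f (Projectivization.mk ℂ (EuclideanSpace.single 0 1 : V n) hs) with hx
    have hr := pr_mk_self x.rep x.rep_nonzero
    rw [x.mk_rep] at hr
    have h0 : ‖x.rep‖ ≠ 0 := norm_ne_zero_iff.2 x.rep_nonzero
    refine ⟨((‖x.rep‖⁻¹ : ℝ) : ℂ) • x.rep, ?_, ?_⟩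
    · rw [norm_smul]; simp [h0]
    · intro k
      have : Q (0, k) = pr x := by
        simp only [Q, ContinuousMap.coe_mk, hx]
        congr 3
        simp [Dpath]
      rw [this, map_smul, hr]
  obtain ⟨v1, h1, h2, -⟩ := transport Q (fun p v => pr_idem _ _) ⟨fun _ => u, continuous_const⟩
    (fun _ => hu) (fun k => hu' k)
  refine ⟨v1, h1, fun z => ?_⟩
  have : Q (1, z) = pr (f (Projectivization.mk ℂ z.1 (Dd_ne z))) := by
    simp only [Q, ContinuousMap.coe_mk]
    congr 3
    simp [Dpath]
  rw [← this]; exact h2 z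

end TCP
end

section
open scoped LinearAlgebra.Projectivization
namespace TCP

theorem lift_D2 {n m : ℕ} (hn : 1 ≤ n) (f : C(CP n, CP m)) : ∃ (d : ℤ) (g : C(Dd n, V m)), (∀ z, ‖g z‖ = 1) ∧
    (∀ z, pr (f (Projectivization.mk ℂ z.1 (Dd_ne z))) (g z) = g z) ∧
    ∀ (z w : Dd n) (l : ℂ), ‖l‖ = 1 → z.1 0 = 0 → w.1 = l • z.1 → g w = l ^ d • g z := by
  obtain ⟨g, hg1, hg2⟩ := lift_D f
  obtain ⟨hpre, hnon⟩ := Bb_pre n hn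
  let R : ℝ → Bb n → Bb n := fun t z => ⟨((Circle.exp t : Circle) : ℂ) • z.1, by
    rw [norm_smul, Circle.norm_coe, one_mul]; exact z.2.1, by simp [z.2.2]⟩
  have hRc : Continuous fun p : ℝ × Bb n => R p.1 p.2 := by
    refine Continuous.subtype_mk ?_ _
    fun_prop
  have hbd : Continuous (bd : Bb n → Dd n) := by
    unfold bd
    exact Continuous.subtype_mk continuous_subtype_val _
  have hR2 : ∀ x, R (2 * Real.pi) x = x := by
    intro x; ext1; simp [R]
  have hRadd : ∀ s t x, R (s + t) x = R s (R t x) := by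
    intro s t x; ext1; simp [R, Circle.exp_add, mul_smul]
  have hlu : ∀ t z, g (bd (R t z)) = (inner ℂ (g (bd z)) (g (bd (R t z))) : ℂ) • g (bd z) ∧
      ‖(inner ℂ (g (bd z)) (g (bd (R t z))) : ℂ)‖ = 1 := by
    intro t z
    refine line_unit (f (Projectivization.mk ℂ (bd z).1 (Dd_ne (bd z)))) _ _ (hg1 _) (hg1 _) (hg2 (bd z)) ?_
    have e : Projectivization.mk ℂ (bd (R t z)).1 (Dd_ne _) = Projectivization.mk ℂ (bd z).1 (Dd_ne (bd z)) := by
      rw [Projectivization.mk_eq_mk_iff']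
      exact ⟨((Circle.exp t : Circle) : ℂ), rfl⟩
    rw [← e]; exact hg2 _
  let c : ℝ → Bb n → Circle := fun t z =>
    ⟨inner ℂ (g (bd z)) (g (bd (R t z))), mem_sphere_zero_iff_norm.2 (hlu t z).2⟩
  have hcd : ∀ t z, g (bd (R t z)) = (c t z : ℂ) • g (bd z) := fun t z => (hlu t z).1
  have hc : Continuous fun p : ℝ × Bb n => c p.1 p.2 := by
    refine Continuous.subtype_mk ?_ _
    refine Continuous.inner ?_ ?_
    · exact g.continuous.comp (hbd.comp continuous_snd)
    · exact g.continuous.comp (hbd.comp hRc)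
  have hgne : ∀ z, g z ≠ 0 := by
    intro z h
    have := hg1 z
    rw [h] at this
    simp at this
  have hcc : ∀ s t x, c (s + t) x = c s (R t x) * c t x := by
    intro s t x
    ext1
    apply smul_left_injective ℂ (hgne (bd x))
    simp only
    rw [← hcd, hRadd, hcd, hcd, Circle.coe_mul, mul_smul]
  have hc2 : ∀ x, c (2 * Real.pi) x = 1 := by
    intro x
    ext1
    apply smul_left_injective ℂ (hgne (bd x))
    simp only
    rw [← hcd, hR2]; simp
  clear_value c
  obtain ⟨d, k, hk⟩ := cocycle_triv R hRc hR2 c hc hcc hc2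
  have hcl : Topology.IsClosedEmbedding (bd : Bb n → Dd n) := by
    refine Topology.IsClosedEmbedding.mk ⟨⟨?_⟩, ?_⟩ ?_
    · rw [instTopologicalSpaceSubtype, instTopologicalSpaceSubtype, induced_compose]; rfl
    · intro a b h
      exact Subtype.ext (congrArg (fun q : Dd n => q.1) h)
    · have : Set.range (bd : Bb n → Dd n) = {z | z.1 0 = 0} := by
        ext z
        constructor
        · rintro ⟨w, rfl⟩; exact w.2.2
        · intro h; exact ⟨⟨z.1, z.2.1, h⟩, rfl⟩
      rw [this]
      exact isClosed_eq (by fun_prop) (by fun_prop)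
  obtain ⟨kk, hkk⟩ := k.exists_extension hcl
  refine ⟨d, ⟨fun z => ((Circle.exp (kk z) : Circle) : ℂ) • g z, ?_⟩, ?_, ?_, ?_⟩
  · fun_prop
  · intro z
    simp [norm_smul, hg1]
  · intro z
    simp only [ContinuousMap.coe_mk, map_smul, hg2]
  · intro z w l hl hz hw
    obtain ⟨t, ht, rfl⟩ := circle_exp_Icc l hl
    let b : Bb n := ⟨z.1, z.2.1, hz⟩
    have e1 : z = bd b := rfl
    have e2 : w = bd (R t b) := by ext1; exact hw
    have e3 : ∀ x, kk (bd x) = k x := fun x => DFunLike.congr_fun hkk x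
    clear_value b
    simp only [ContinuousMap.coe_mk]
    rw [e1, e2, hcd, e3, e3, hk t ht, smul_smul, smul_smul, ← Circle.coe_zpow, ← Circle.coe_mul, ← Circle.coe_mul,
      ← Circle.exp_intCast_mul, ← Circle.exp_add, ← Circle.exp_add]
    congr 3
    ring

theorem degree_lift {n m : ℕ} (hn : 1 ≤ n) (f : C(CP n, CP m)) : ∃ (d : ℤ) (F : C(S n, V m)), (∀ z, ‖F z‖ = 1) ∧
    (∀ z, pr (f (smk z)) (F z) = F z) ∧
    ∀ (z w : S n) (l : ℂ), ‖l‖ = 1 → w.1 = l • z.1 → F w = l ^ d • F z := by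
  obtain ⟨d, g, hg1, hg2, hg3⟩ := lift_D2 hn f
  let Φ : Circle × Dd n → S n := fun p => ⟨(p.1 : ℂ) • p.2.1, by
    rw [mem_sphere_zero_iff_norm, norm_smul, Circle.norm_coe, one_mul]; exact p.2.2.1⟩
  have hΦc : Continuous Φ := by
    refine Continuous.subtype_mk ?_ _
    fun_prop
  have hΦs : Function.Surjective Φ := by
    intro z
    have hz : ‖z.1‖ = 1 := by simpa using z.2
    by_cases h : z.1 0 = 0
    · refine ⟨(1, ⟨z.1, hz, by simp [h], by simp [h]⟩), ?_⟩
      ext1; simp [Φ]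
    · have hn0 : ‖z.1 0‖ ≠ 0 := norm_ne_zero_iff.2 h
      have hn1 : ((‖z.1 0‖ : ℝ) : ℂ) ≠ 0 := by exact_mod_cast hn0
      let l : Circle := ⟨z.1 0 / ‖z.1 0‖, mem_sphere_zero_iff_norm.2 (by simp [hn0])⟩
      have hl : (l : ℂ) = z.1 0 / ‖z.1 0‖ := rfl
      have h1 : ((l⁻¹ : Circle) : ℂ) * z.1 0 = ‖z.1 0‖ := by
        rw [Circle.coe_inv, hl]; field_simp
      refine ⟨(l, ⟨((l⁻¹ : Circle) : ℂ) • z.1, ?_, ?_, ?_⟩), ?_⟩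
      · rw [norm_smul, Circle.norm_coe, one_mul, hz]
      · rw [PiLp.smul_apply, smul_eq_mul, h1]; simp
      · rw [PiLp.smul_apply, smul_eq_mul, h1]; simp
      · ext1
        simp only [Φ, smul_smul, ← Circle.coe_mul]; simp
  have hq : Topology.IsQuotientMap Φ := hΦc.isClosedMap.isQuotientMap hΦc hΦs
  let Ψ : C(Circle × Dd n, V m) := ⟨fun p => ((p.1 ^ d : Circle) : ℂ) • g p.2, by
    have h1 : Continuous fun p : Circle × Dd n => p.1 ^ d := continuous_fst.zpow d
    exact ((by fun_prop : Continuous fun c : Circle => (c : ℂ)).comp h1).fun_smul (g.continuous.comp continuous_snd)⟩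
  have hΨ : ∀ a b, Φ a = Φ b → Ψ a = Ψ b := by
    rintro ⟨l, y⟩ ⟨l', y'⟩ h
    have h : (l : ℂ) • y.1 = (l' : ℂ) • y'.1 := congrArg Subtype.val h
    have h' : y'.1 = (((l'⁻¹ * l : Circle)) : ℂ) • y.1 := by
      rw [Circle.coe_mul, mul_smul, h, smul_smul, ← Circle.coe_mul]; simp
    by_cases h0 : y.1 0 = 0
    · have := hg3 y y' _ (Circle.norm_coe _) h0 h'
      simp only [Ψ, ContinuousMap.coe_mk]
      rw [this, smul_smul, ← Circle.coe_zpow, ← Circle.coe_mul, mul_zpow, inv_zpow, ← mul_assoc, mul_inv_cancel, one_mul]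
    · have h1 : ∀ z : Dd n, z.1 0 = ((‖z.1 0‖ : ℝ) : ℂ) := by
        intro z
        have h2 : z.1 0 = (((z.1 0).re : ℝ) : ℂ) := by
          apply Complex.ext
          · simp
          · simp [z.2.2.2]
        rw [h2, Complex.norm_real, Real.norm_of_nonneg z.2.2.1]
      have h2 : y'.1 0 = (((l'⁻¹ * l : Circle)) : ℂ) * y.1 0 := by rw [h']; rfl
      have h3 : ‖y'.1 0‖ = ‖y.1 0‖ := by rw [h2, norm_mul, Circle.norm_coe, one_mul]
      have h4 : y'.1 0 = y.1 0 := by rw [h1 y', h1 y, h3]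
      rw [h4] at h2
      have h5 : (((l'⁻¹ * l : Circle)) : ℂ) = 1 := by
        apply mul_right_cancel₀ h0
        rw [← h2, one_mul]
      have h6 : l'⁻¹ * l = 1 := by ext1; simpa using h5
      have h7 : l = l' := (inv_mul_eq_one.1 h6).symm
      have h8 : y' = y := by ext1; rw [h', h6]; simp
      rw [h7, h8]
  have hq' : Topology.IsQuotientMap (⟨Φ, hΦc⟩ : C(Circle × Dd n, S n)) := hq
  let F : C(S n, V m) := hq'.lift Ψ (fun a b h => hΨ a b h)
  have hF : ∀ a, F (Φ a) = Ψ a := fun a => DFunLike.congr_fun (hq'.lift_comp Ψ (fun a b h => hΨ a b h)) a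
  clear_value F
  refine ⟨d, F, ?_, ?_, ?_⟩
  · intro z
    obtain ⟨a, rfl⟩ := hΦs z
    rw [hF]
    simp only [Ψ, ContinuousMap.coe_mk]
    rw [norm_smul, Circle.norm_coe, hg1, one_mul]
  · intro z
    obtain ⟨a, rfl⟩ := hΦs z
    rw [hF]
    have e : smk (Φ a) = Projectivization.mk ℂ a.2.1 (Dd_ne a.2) := by
      rw [smk, Projectivization.mk_eq_mk_iff']
      exact ⟨a.1, rfl⟩
    rw [e]
    simp only [Ψ, ContinuousMap.coe_mk, map_smul, hg2]
  · intro z w l hl h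
    obtain ⟨⟨l', y⟩, rfl⟩ := hΦs z
    obtain ⟨l, rfl⟩ : ∃ c : Circle, (c : ℂ) = l := ⟨⟨l, mem_sphere_zero_iff_norm.2 hl⟩, rfl⟩
    have : w = Φ (l * l', y) := by
      ext1
      rw [h]
      simp only [Φ, smul_smul, Circle.coe_mul]
    rw [this, hF, hF]
    simp only [Ψ, ContinuousMap.coe_mk]
    rw [mul_zpow, Circle.coe_mul, mul_smul, Circle.coe_zpow]

end TCP
end

section
open scoped LinearAlgebra.Projectivization
namespace TCP

instance (n : ℕ) : T2Space (CP n) := by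
  refine T2Space.of_injective_continuous (f := pr) ?_ (continuous_pr n)
  intro x y h
  have hx := pr_mk_self x.rep x.rep_nonzero
  rw [x.mk_rep, h] at hx
  have := mk_eq_of_pr y x.rep x.rep_nonzero hx
  rwa [x.mk_rep] at this

theorem smk_surj {n : ℕ} (x : CP n) : ∃ z : S n, smk z = x := by
  have h0 : ‖x.rep‖ ≠ 0 := norm_ne_zero_iff.2 x.rep_nonzero
  refine ⟨⟨((‖x.rep‖⁻¹ : ℝ) : ℂ) • x.rep, ?_⟩, ?_⟩
  · rw [mem_sphere_zero_iff_norm, norm_smul]; simp [h0]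
  · conv_rhs => rw [← x.mk_rep]
    rw [smk, Projectivization.mk_eq_mk_iff']
    exact ⟨_, rfl⟩

theorem smk_fiber {n : ℕ} (z w : S n) (h : smk z = smk w) : ∃ l : ℂ, ‖l‖ = 1 ∧ z.1 = l • w.1 := by
  rw [smk, smk, Projectivization.mk_eq_mk_iff'] at h
  obtain ⟨l, hl⟩ := h
  refine ⟨l, ?_, hl.symm⟩
  have := congrArg norm hl
  rw [norm_smul, mem_sphere_zero_iff_norm.1 z.2, mem_sphere_zero_iff_norm.1 w.2, mul_one] at this
  exact this

theorem smk_quot (n : ℕ) : Topology.IsQuotientMap (smk : S n → CP n) :=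
  (continuous_smk n).isClosedMap.isQuotientMap (continuous_smk n) smk_surj

theorem rot {n : ℕ} (z : S n) : ∃ (w : S n) (l : ℂ), ‖l‖ = 1 ∧ w.1 = l • z.1 ∧ (w.1 0).im = 0 := by
  by_cases h : z.1 0 = 0
  · exact ⟨z, 1, by simp, by simp, by simp [h]⟩
  · have h0 : ‖z.1 0‖ ≠ 0 := norm_ne_zero_iff.2 h
    have h1 : ‖(starRingEnd ℂ) (z.1 0) / ‖z.1 0‖‖ = 1 := by simp [h0]
    refine ⟨⟨((starRingEnd ℂ) (z.1 0) / ‖z.1 0‖) • z.1, ?_⟩, _, h1, rfl, ?_⟩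
    · rw [mem_sphere_zero_iff_norm, norm_smul, h1, mem_sphere_zero_iff_norm.1 z.2, one_mul]
    · simp only [PiLp.smul_apply, smul_eq_mul]
      rw [div_mul_eq_mul_div, mul_comm, Complex.mul_conj]
      rw [← Complex.ofReal_div]; exact Complex.ofReal_im _

noncomputable def mkC {X : Type} [TopologicalSpace X] {n : ℕ} (a : C(X, V n)) (h : ∀ x, a x ≠ 0) : C(X, CP n) :=
  ⟨fun x => Projectivization.mk ℂ (a x) (h x), continuous_mk _ a.continuous _⟩

theorem mkC_homotopic {X : Type} [TopologicalSpace X] {n : ℕ} (a b : C(X, V n)) (ha : ∀ x, a x ≠ 0) (hb : ∀ x, b x ≠ 0)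
    (h : ∀ x (s t : ℝ), 0 ≤ s → 0 ≤ t → s + t = 1 → s • a x + t • b x ≠ 0) : (mkC a ha).Homotopic (mkC b hb) := by
  have h' : ∀ p : unitInterval × X, (1 - (p.1 : ℝ)) • a p.2 + (p.1 : ℝ) • b p.2 ≠ 0 :=
    fun p => h _ _ _ (sub_nonneg.2 p.1.2.2) p.1.2.1 (by ring)
  refine ⟨⟨⟨fun p => Projectivization.mk ℂ _ (h' p), ?_⟩, ?_, ?_⟩⟩
  · apply continuous_mk
    fun_prop
  · intro x
    simp [mkC]
  · intro x
    simp [mkC]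

theorem inv_smul_S {n : ℕ} (l : ℂ) (hl : ‖l‖ = 1) (y : S n) : l • y.1 ∈ S n := by
  rw [mem_sphere_zero_iff_norm, norm_smul, hl, mem_sphere_zero_iff_norm.1 y.2, one_mul]

theorem S_nonempty (n : ℕ) : Nonempty (S n) :=
  ⟨⟨EuclideanSpace.single 0 1, by simp⟩⟩

theorem approx_lip {n : ℕ} (u : C(S n, ℝ)) (hu : ∀ (z w : S n) (l : ℂ), ‖l‖ = 1 → w.1 = l • z.1 → u w = u z)
    (e : ℝ) (he : 0 < e) : ∃ (K : ℝ) (G : V n → ℝ), 0 ≤ K ∧ (∀ x y, |G x - G y| ≤ K * ‖x - y‖) ∧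
      (∀ z : S n, |G z.1 - u z| ≤ e) ∧ ∀ (l : ℂ) x, ‖l‖ = 1 → G (l • x) = G x := by
  have hne := S_nonempty n
  have huc := CompactSpace.uniformContinuous_of_continuous u.continuous
  rw [Metric.uniformContinuous_iff] at huc
  obtain ⟨δ, hδ, huc⟩ := huc e he
  obtain ⟨M, hM⟩ : ∃ M, ∀ z, |u z| ≤ M := ⟨‖u‖, fun z => u.norm_coe_le_norm z⟩
  have hM0 : 0 ≤ M := (abs_nonneg _).trans (hM hne.some)
  set K := 2 * M / δ with hK
  have hK0 : 0 ≤ K := by positivity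
  have hKd : K * δ = 2 * M := by rw [hK]; field_simp
  have hbdd : ∀ x : V n, BddBelow (Set.range fun y : S n => u y + K * ‖x - y.1‖) := by
    intro x
    refine ⟨-M, ?_⟩
    rintro _ ⟨y, rfl⟩
    have := (abs_le.1 (hM y)).1
    have : 0 ≤ K * ‖x - y.1‖ := by positivity
    simp only; linarith
  have hinv : ∀ (l : ℂ) x, ‖l‖ = 1 → (⨅ y : S n, (u y + K * ‖l • x - y.1‖)) ≤ ⨅ y : S n, (u y + K * ‖x - y.1‖) := by
    intro l x hl
    refine le_ciInf fun y => ?_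
    refine (ciInf_le (hbdd _) ⟨l • y.1, inv_smul_S l hl y⟩).trans ?_
    rw [hu y ⟨l • y.1, inv_smul_S l hl y⟩ l hl rfl, ← smul_sub, norm_smul, hl, one_mul]
  have hle : ∀ x y : V n, (⨅ z : S n, (u z + K * ‖x - z.1‖)) ≤ (⨅ z : S n, (u z + K * ‖y - z.1‖)) + K * ‖x - y‖ := by
    intro x y
    rw [← sub_le_iff_le_add]
    refine le_ciInf fun z => ?_
    rw [sub_le_iff_le_add]
    refine (ciInf_le (hbdd _) z).trans ?_
    have := norm_sub_le_norm_sub_add_norm_sub x y z.1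
    nlinarith
  refine ⟨K, fun x => ⨅ y : S n, (u y + K * ‖x - y.1‖), hK0, ?_, ?_, ?_⟩
  · intro x y
    rw [abs_le]
    have h1 := hle x y
    have h2 := hle y x
    rw [norm_sub_rev y x] at h2
    constructor <;> linarith
  · intro z
    have h1 : (⨅ y : S n, (u y + K * ‖z.1 - y.1‖)) ≤ u z := by
      refine (ciInf_le (hbdd _) z).trans ?_
      simp
    have h2 : u z - e ≤ ⨅ y : S n, (u y + K * ‖z.1 - y.1‖) := by
      refine le_ciInf fun y => ?_
      by_cases hd : dist z y < δ
      · have h3 := huc hd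
        rw [Real.dist_eq] at h3
        have h4 := (abs_lt.1 h3).2
        have : 0 ≤ K * ‖z.1 - y.1‖ := by positivity
        linarith
      · have h3 : δ ≤ ‖z.1 - y.1‖ := by
          rw [← dist_eq_norm]; exact not_lt.1 hd
        have h4 : K * δ ≤ K * ‖z.1 - y.1‖ := mul_le_mul_of_nonneg_left h3 hK0
        have h5 := abs_le.1 (hM z)
        have h6 := abs_le.1 (hM y)
        linarith [h5.2, h6.1]
    rw [abs_le]
    constructor <;> linarith
  · intro l x hl
    have hl0 : l ≠ 0 := by rintro rfl; simp at hl
    refine le_antisymm (hinv l x hl) ?_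
    have := hinv l⁻¹ (l • x) (by simp [hl])
    rwa [smul_smul, inv_mul_cancel₀ hl0, one_smul] at this

theorem approx_vec {n m : ℕ} (F : C(S n, V m)) (hu : ∀ (z w : S n) (l : ℂ), ‖l‖ = 1 → w.1 = l • z.1 → F w = F z)
    (e : ℝ) (he : 0 < e) : ∃ (K : ℝ) (G : V n → V m), 0 ≤ K ∧ (∀ x y, ‖G x - G y‖ ≤ K * ‖x - y‖) ∧
      (∀ z : S n, ‖G z.1 - F z‖ ≤ e) ∧ ∀ (l : ℂ) x, ‖l‖ = 1 → G (l • x) = G x := by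
  have hN : (0 : ℝ) < 2 * (m + 1) := by positivity
  have hre := fun j : Fin (m + 1) => approx_lip (n := n) ⟨fun z => (F z j).re, by fun_prop⟩
    (fun z w l h1 h2 => by simp [hu z w l h1 h2]) (e / (2 * (m + 1))) (by positivity)
  have him := fun j : Fin (m + 1) => approx_lip (n := n) ⟨fun z => (F z j).im, by fun_prop⟩
    (fun z w l h1 h2 => by simp [hu z w l h1 h2]) (e / (2 * (m + 1))) (by positivity)
  choose K A hK hA1 hA2 hA3 using hre
  choose L B hL hB1 hB2 hB3 using him
  have hno : ∀ (v : V m) (c : Fin (m + 1) → ℝ), (∀ j, |(v j).re| + |(v j).im| ≤ c j) → ‖v‖ ≤ ∑ j, c j := by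
    intro v c h
    have : v = ∑ j, EuclideanSpace.single j (v j) := by
      ext i
      simp
    rw [this]
    refine (norm_sum_le _ _).trans (Finset.sum_le_sum fun j _ => ?_)
    rw [EuclideanSpace.norm_single]
    exact (Complex.norm_le_abs_re_add_abs_im _).trans (h j)
  refine ⟨∑ j, (K j + L j), fun x => WithLp.toLp 2 fun j => ⟨A j x, B j x⟩, ?_, ?_, ?_, ?_⟩
  · exact Finset.sum_nonneg fun j _ => add_nonneg (hK j) (hL j)
  · intro x y
    rw [Finset.sum_mul]
    apply hno
    intro j
    simp only [PiLp.sub_apply, Complex.sub_re, Complex.sub_im]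
    rw [add_mul]
    exact add_le_add (hA1 j x y) (hB1 j x y)
  · intro z
    refine (hno _ (fun _ => e / (m + 1)) ?_).trans (le_of_eq ?_)
    · intro j
      simp only [PiLp.sub_apply, Complex.sub_re, Complex.sub_im]
      have h1 := hA2 j z
      have h2 := hB2 j z
      simp only [ContinuousMap.coe_mk] at h1 h2
      have : e / (m + 1) = e / (2 * (m + 1)) + e / (2 * (m + 1)) := by field_simp; ring
      rw [this]
      exact add_le_add h1 h2
    · simp
      field_simp
  · intro l x hl
    ext j
    simp [hA3 j l x hl, hB3 j l x hl]

end TCP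
end

section
open scoped LinearAlgebra.Projectivization
namespace TCP

noncomputable def imT (n : ℕ) : V n →ₗ[ℝ] ℝ where
  toFun x := (x 0).im
  map_add' x y := by simp
  map_smul' r x := by simp

theorem imT_rank (n : ℕ) : Module.finrank ℝ (LinearMap.ker (imT n)) = 2 * n + 1 := by
  have h1 := LinearMap.finrank_range_add_finrank_ker (imT n)
  have h2 : LinearMap.range (imT n) = ⊤ := by
    rw [LinearMap.range_eq_top]
    intro r
    refine ⟨EuclideanSpace.single 0 ⟨0, r⟩, ?_⟩
    change ((EuclideanSpace.single 0 ⟨0, r⟩ : V n) 0).im = r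
    simp
  have h3 : Module.finrank ℝ (V n) = 2 * (n + 1) := by
    rw [← Module.finrank_mul_finrank ℝ ℂ]; simp
  rw [h2, finrank_top, h3] at h1
  simp at h1
  omega

noncomputable def hom1 {n m : ℕ} (G : V n → V m) (x : V n) : V m := ‖x‖ • G (‖x‖⁻¹ • x)

theorem hom1_lip {n m : ℕ} (G : V n → V m) (K B : ℝ) (hK : 0 ≤ K) (hB : 0 ≤ B)
    (hG : ∀ x y, ‖G x - G y‖ ≤ K * ‖x - y‖) (hGB : ∀ x, ‖x‖ = 1 → ‖G x‖ ≤ B) (x y : V n) :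
    ‖hom1 G x - hom1 G y‖ ≤ (B + 2 * K) * ‖x - y‖ := by
  have hb : ∀ x, ‖hom1 G x‖ ≤ B * ‖x‖ := by
    intro x
    by_cases hx : x = 0
    · simp [hom1, hx]
    · have hx' := norm_ne_zero_iff.2 hx
      rw [hom1, norm_smul, norm_norm, mul_comm]
      refine mul_le_mul_of_nonneg_right (hGB _ ?_) (norm_nonneg _)
      rw [norm_smul]; simp [hx']
  by_cases hy : y = 0
  · subst hy
    simp only [sub_zero]
    have h0 : hom1 G 0 = 0 := by simp [hom1]
    rw [h0, sub_zero]
    refine (hb x).trans ?_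
    nlinarith [norm_nonneg x]
  by_cases hx : x = 0
  · subst hx
    have h0 : hom1 G 0 = 0 := by simp [hom1]
    rw [h0, zero_sub, zero_sub, norm_neg, norm_neg]
    refine (hb y).trans ?_
    nlinarith [norm_nonneg y]
  have hx' := norm_ne_zero_iff.2 hx
  have hy' := norm_ne_zero_iff.2 hy
  have e : hom1 G x - hom1 G y = (‖x‖ - ‖y‖) • G (‖y‖⁻¹ • y) + ‖x‖ • (G (‖x‖⁻¹ • x) - G (‖y‖⁻¹ • y)) := by
    simp only [hom1, sub_smul, smul_sub]; abel
  have h1 : ‖G (‖y‖⁻¹ • y)‖ ≤ B := hGB _ (by rw [norm_smul]; simp [hy'])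
  have h2 : ‖x‖ * ‖‖x‖⁻¹ • x - ‖y‖⁻¹ • y‖ ≤ 2 * ‖x - y‖ := by
    have : ‖x‖ * ‖‖x‖⁻¹ • x - ‖y‖⁻¹ • y‖ = ‖(x - y) + ((‖y‖ - ‖x‖) * ‖y‖⁻¹) • y‖ := by
      rw [← norm_norm x, ← norm_smul, norm_norm]
      congr 1
      rw [smul_sub, smul_smul, smul_smul, mul_inv_cancel₀ hx', one_smul, sub_mul, mul_inv_cancel₀ hy', sub_smul, one_smul]
      abel
    rw [this]
    refine (norm_add_le _ _).trans ?_
    rw [norm_smul, norm_mul, norm_inv, norm_norm, mul_assoc, inv_mul_cancel₀ hy', mul_one, Real.norm_eq_abs]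
    have := abs_norm_sub_norm_le y x
    rw [norm_sub_rev] at this
    linarith
  rw [e]
  refine (norm_add_le _ _).trans ?_
  rw [norm_smul, norm_smul, norm_norm, Real.norm_eq_abs]
  have h3 := abs_norm_sub_norm_le x y
  have h4 := hG (‖x‖⁻¹ • x) (‖y‖⁻¹ • y)
  have h5 : ‖x‖ * ‖G (‖x‖⁻¹ • x) - G (‖y‖⁻¹ • y)‖ ≤ K * (2 * ‖x - y‖) := by
    calc _ ≤ ‖x‖ * (K * ‖‖x‖⁻¹ • x - ‖y‖⁻¹ • y‖) := mul_le_mul_of_nonneg_left h4 (norm_nonneg _)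
      _ = K * (‖x‖ * ‖‖x‖⁻¹ • x - ‖y‖⁻¹ • y‖) := by ring
      _ ≤ _ := mul_le_mul_of_nonneg_left h2 hK
  have h6 : |‖x‖ - ‖y‖| * ‖G (‖y‖⁻¹ • y)‖ ≤ ‖x - y‖ * B := mul_le_mul h3 h1 (norm_nonneg _) (norm_nonneg _)
  nlinarith

theorem miss {n m : ℕ} (hnm : n ≤ m) (G : V n → V m) (K B : ℝ) (hK : 0 ≤ K) (hB : 0 ≤ B)
    (hG : ∀ x y, ‖G x - G y‖ ≤ K * ‖x - y‖) (hGB : ∀ x, ‖x‖ = 1 → ‖G x‖ ≤ B) :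
    ∃ v : V m, ∀ x : V n, (x 0).im = 0 → hom1 G x ≠ v := by
  let g : LinearMap.ker (imT n) → V m := fun x => hom1 G x.1
  have hg : LipschitzWith (Real.toNNReal (B + 2 * K)) g := by
    refine LipschitzWith.of_dist_le_mul fun x y => ?_
    rw [Real.coe_toNNReal _ (by positivity), dist_eq_norm, dist_eq_norm]
    exact hom1_lip G K B hK hB hG hGB x.1 y.1
  have h1 := hg.dimH_range_le
  rw [Real.dimH_univ_eq_finrank, imT_rank] at h1
  have h3 : Module.finrank ℝ (V m) = 2 * (m + 1) := by
    rw [← Module.finrank_mul_finrank ℝ ℂ]; simp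
  have h2 : dimH (Set.range g) < Module.finrank ℝ (V m) := by
    refine h1.trans_lt ?_
    rw [h3]
    have : 2 * n + 1 < 2 * (m + 1) := by omega
    exact_mod_cast this
  obtain ⟨v, hv⟩ := (dense_compl_of_dimH_lt_finrank h2).nonempty
  refine ⟨v, fun x hx h => hv ⟨⟨x, ?_⟩, h⟩⟩
  exact hx

theorem null_of_zero {n m : ℕ} (hnm : n ≤ m) (f : C(CP n, CP m)) (F : C(S n, V m)) (hF1 : ∀ z, ‖F z‖ = 1)
    (hF2 : ∀ z, pr (f (smk z)) (F z) = F z)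
    (hF3 : ∀ (z w : S n) (l : ℂ), ‖l‖ = 1 → w.1 = l • z.1 → F w = F z) : f.Nullhomotopic := by
  obtain ⟨K, G, hK, hG1, hG2, hG3⟩ := approx_vec F hF3 (1 / 2) (by norm_num)
  have hGB : ∀ x, ‖x‖ = 1 → ‖G x‖ ≤ 2 := by
    intro x hx
    have h1 := hG2 ⟨x, mem_sphere_zero_iff_norm.2 hx⟩
    have h2 := norm_le_norm_add_norm_sub' (G x) (F ⟨x, mem_sphere_zero_iff_norm.2 hx⟩)
    rw [hF1] at h2
    simp only at h1
    linarith
  obtain ⟨v, hv⟩ := miss hnm G K 2 hK (by norm_num) hG1 hGB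
  have hv0 : v ≠ 0 := by
    intro h
    exact hv 0 (by simp) (by simp [hom1, h])
  have hq : Topology.IsQuotientMap (⟨smk, continuous_smk n⟩ : C(S n, CP n)) := smk_quot n
  have hGc : Continuous G := by
    have : LipschitzWith (Real.toNNReal K) G := by
      refine LipschitzWith.of_dist_le_mul fun x y => ?_
      rw [Real.coe_toNNReal _ hK, dist_eq_norm, dist_eq_norm]
      exact hG1 x y
    exact this.continuous
  obtain ⟨F', hF'⟩ : ∃ F' : C(CP n, V m), ∀ z, F' (smk z) = F z := by
    have : Function.FactorsThrough F (⟨smk, continuous_smk n⟩ : C(S n, CP n)) := by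
      intro z w h
      obtain ⟨l, hl, hzw⟩ := smk_fiber z w h
      exact hF3 w z l hl hzw
    exact ⟨hq.lift F this, fun a => DFunLike.congr_fun (hq.lift_comp F this) a⟩
  obtain ⟨G', hG'⟩ : ∃ G' : C(CP n, V m), ∀ z, G' (smk z) = G z.1 := by
    let G0 : C(S n, V m) := ⟨fun z => G z.1, by fun_prop⟩
    have : Function.FactorsThrough G0 (⟨smk, continuous_smk n⟩ : C(S n, CP n)) := by
      intro z w h
      obtain ⟨l, hl, hzw⟩ := smk_fiber z w h
      simp only [G0, ContinuousMap.coe_mk]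
      rw [hzw, hG3 l _ hl]
    exact ⟨hq.lift G0 this, fun a => DFunLike.congr_fun (hq.lift_comp G0 this) a⟩
  have hF'0 : ∀ x, F' x ≠ 0 := by
    intro x h
    obtain ⟨z, rfl⟩ := smk_surj x
    rw [hF'] at h
    have := hF1 z
    rw [h] at this
    simp at this
  have hFG : ∀ x (s t : ℝ), 0 ≤ s → 0 ≤ t → s + t = 1 → s • F' x + t • G' x ≠ 0 := by
    intro x s t hs ht hst h
    obtain ⟨z, rfl⟩ := smk_surj x
    rw [hF', hG'] at h
    have h1 : F z = - (t • (G z.1 - F z)) := by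
      have : s = 1 - t := by linarith
      rw [this, sub_smul, one_smul] at h
      rw [smul_sub, eq_neg_iff_add_eq_zero, ← h]; abel
    have h2 := congrArg norm h1
    rw [hF1, norm_neg, norm_smul, Real.norm_of_nonneg ht] at h2
    have := hG2 z
    nlinarith [norm_nonneg (G z.1 - F z)]
  have hG'0 : ∀ x, G' x ≠ 0 := by
    intro x
    have := hFG x 0 1 (by simp) (by simp) (by simp)
    simpa using this
  have hGv : ∀ x (s t : ℝ), 0 ≤ s → 0 ≤ t → s + t = 1 →
      s • G' x + t • (ContinuousMap.const (CP n) (-v)) x ≠ 0 := by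
    intro x s t hs ht hst h
    rcases ht.eq_or_lt with ht0 | ht0
    · rw [← ht0, add_zero] at hst
      rw [← ht0, hst] at h
      simp at h
      exact hG'0 x h
    obtain ⟨z, rfl⟩ := smk_surj x
    obtain ⟨w, l, hl, hw, him⟩ := rot z
    rw [← smk_eq z w l hw, hG'] at h
    simp only [ContinuousMap.const_apply, smul_neg, ← sub_eq_add_neg, sub_eq_zero] at h
    have hw1 : ‖w.1‖ = 1 := mem_sphere_zero_iff_norm.1 w.2
    apply hv ((s / t) • w.1) (by simp [him])
    rw [hom1, norm_smul, hw1, mul_one, Real.norm_of_nonneg (div_nonneg hs ht)]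
    rcases hs.eq_or_lt with hs0 | hs0
    · rw [← hs0, zero_smul] at h
      have := (smul_eq_zero.1 h.symm).resolve_left ht0.ne'
      exact absurd this hv0
    · rw [smul_smul, inv_mul_cancel₀ (by positivity), one_smul]
      rw [div_eq_inv_mul, mul_smul, h, smul_smul, inv_mul_cancel₀ ht0.ne', one_smul]
  refine ⟨Projectivization.mk ℂ (-v) (neg_ne_zero.2 hv0), ?_⟩
  have e1 : f = mkC F' hF'0 := by
    ext x
    obtain ⟨z, rfl⟩ := smk_surj x
    simp only [mkC, ContinuousMap.coe_mk]
    symm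
    apply mk_eq_of_pr
    rw [hF']; exact hF2 z
  rw [e1]
  exact (mkC_homotopic F' G' hF'0 hG'0 hFG).trans
    (mkC_homotopic G' (ContinuousMap.const _ (-v)) hG'0 (fun _ => neg_ne_zero.2 hv0) hGv)

end TCP
end

section
open scoped LinearAlgebra.Projectivization
namespace TCP

noncomputable def sm2 {n : ℕ} (p : S n × S n) : CP n × CP n := (smk p.1, smk p.2)

theorem continuous_sm2 (n : ℕ) : Continuous (sm2 : S n × S n → _) := by
  unfold sm2
  exact ((continuous_smk n).comp continuous_fst).prodMk ((continuous_smk n).comp continuous_snd)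

instance (n : ℕ) : CompactSpace (CP n) := by
  refine ⟨?_⟩
  have := isCompact_range (continuous_smk n)
  rwa [Set.range_eq_univ.2 smk_surj] at this

theorem local_sec {n m : ℕ} (f : C(CP n, CP m)) (F : C(S n, V m)) (d : ℤ) (hF1 : ∀ z, ‖F z‖ = 1)
    (hF2 : ∀ z, pr (f (smk z)) (F z) = F z)
    (hF3 : ∀ (z w : S n) (l : ℂ), ‖l‖ = 1 → w.1 = l • z.1 → F w = l ^ d • F z)
    (U : Set (CP n × CP n))
    (hU : ((f.comp ContinuousMap.fst).restrict U).Homotopic ((f.comp ContinuousMap.snd).restrict U))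
    (ρ : C(CP n × CP n, ℝ)) (hρ : tsupport ρ ⊆ U) :
    ∃ Fi : C(S n × S n, ℂ), (∀ p, ρ (sm2 p) ≠ 0 → Fi p ≠ 0) ∧
      ∀ (p q : S n × S n) (l μ : ℂ), ‖l‖ = 1 → ‖μ‖ = 1 → q.1.1 = l • p.1.1 → q.2.1 = μ • p.2.1 →
        Fi q = l ^ d * μ ^ (-d) * Fi p := by
  obtain ⟨H⟩ := hU
  have hKc : IsClosed {p : S n × S n | sm2 p ∈ tsupport ρ} := (isClosed_tsupport _).preimage (continuous_sm2 n)
  have hKK : CompactSpace {p : S n × S n | sm2 p ∈ tsupport ρ} := isCompact_iff_compactSpace.1 hKc.isCompact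
  let ι : {p : S n × S n | sm2 p ∈ tsupport ρ} → U := fun p => ⟨sm2 p.1, hρ p.2⟩
  have hι : Continuous ι := Continuous.subtype_mk ((continuous_sm2 n).comp continuous_subtype_val) _
  let Q : C(unitInterval × {p : S n × S n | sm2 p ∈ tsupport ρ}, V m →L[ℂ] V m) :=
    ⟨fun q => pr (H (q.1, ι q.2)), by
      refine (continuous_pr m).comp (H.continuous.comp ?_)
      exact continuous_fst.prodMk (hι.comp continuous_snd)⟩
  obtain ⟨v1, hv1, hv2, hv3⟩ := transport Q (fun p v => pr_idem _ _) ⟨fun p => F p.1.1, by fun_prop⟩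
    (fun k => hF1 _) (by
      intro k
      simp only [Q, ContinuousMap.coe_mk, H.apply_zero]
      exact hF2 k.1.1)
  have hs1 : ∀ p, ‖(inner ℂ (F p.1.2) (v1 p) : ℂ)‖ = 1 := by
    intro p
    refine (line_unit (f (smk p.1.2)) _ _ (hF1 _) (hv1 _) (hF2 _) ?_).2
    have h := hv2 p
    simp only [Q, ContinuousMap.coe_mk, H.apply_one] at h
    exact h
  let s : C({p : S n × S n | sm2 p ∈ tsupport ρ}, ℂ) := ⟨fun p => inner ℂ (F p.1.2) (v1 p), by fun_prop⟩
  obtain ⟨s', hs'⟩ := s.exists_extension hKc.isClosedEmbedding_subtypeVal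
  have hs'' : ∀ p, s' p.1 = s p := fun p => DFunLike.congr_fun hs' p
  refine ⟨⟨fun p => ((ρ (sm2 p) : ℝ) : ℂ) * s' p, ?_⟩, ?_, ?_⟩
  · have : Continuous fun p : S n × S n => ρ (sm2 p) := ρ.continuous.comp (continuous_sm2 n)
    exact (Complex.continuous_ofReal.comp this).mul s'.continuous
  · intro p hp
    simp only [ContinuousMap.coe_mk]
    refine mul_ne_zero (by exact_mod_cast hp) ?_
    rw [hs'' ⟨p, subset_tsupport _ hp⟩, ← norm_ne_zero_iff]
    simp only [s, ContinuousMap.coe_mk]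
    rw [hs1 ⟨p, subset_tsupport _ hp⟩]
    exact one_ne_zero
  · intro p q l μ hl hμ h1 h2
    have e : sm2 q = sm2 p := by
      simp only [sm2]
      rw [smk_eq p.1 q.1 l h1, smk_eq p.2 q.2 μ h2]
    simp only [ContinuousMap.coe_mk]
    rw [e]
    by_cases h0 : ρ (sm2 p) = 0
    · rw [h0]; simp
    have hp : sm2 p ∈ tsupport ρ := subset_tsupport _ h0
    have hq : sm2 q ∈ tsupport ρ := e ▸ hp
    rw [hs'' ⟨p, hp⟩, hs'' ⟨q, hq⟩]
    have hld : ‖l ^ d‖ = 1 := by rw [norm_zpow, hl, one_zpow]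
    have h3 : v1 ⟨q, hq⟩ = l ^ d • v1 ⟨p, hp⟩ := by
      refine hv3 ⟨p, hp⟩ ⟨q, hq⟩ (l ^ d) hld ?_ (hF3 p.1 q.1 l hl h1)
      intro t
      simp only [Q, ContinuousMap.coe_mk, ι, e]
    simp only [s, ContinuousMap.coe_mk]
    rw [h3, hF3 p.2 q.2 μ hμ h2, inner_smul_left, inner_smul_right]
    have h4 : (starRingEnd ℂ) (μ ^ d) = μ ^ (-d) := by
      rw [map_zpow₀, zpow_neg, ← inv_zpow]
      congr 1
      rw [Complex.inv_def, Complex.normSq_eq_norm_sq, hμ]; simp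
    rw [h4]; ring

theorem global_sec {n m : ℕ} (f : C(CP n, CP m)) (F : C(S n, V m)) (d : ℤ) (hF1 : ∀ z, ‖F z‖ = 1)
    (hF2 : ∀ z, pr (f (smk z)) (F z) = F z)
    (hF3 : ∀ (z w : S n) (l : ℂ), ‖l‖ = 1 → w.1 = l • z.1 → F w = l ^ d • F z)
    (k N : ℕ) (hk : k ≤ N) (U : Fin k → Set (CP n × CP n)) (hUo : ∀ i, IsOpen (U i)) (hUc : ⋃ i, U i = Set.univ)
    (hU : ∀ i, ((f.comp ContinuousMap.fst).restrict (U i)).Homotopic ((f.comp ContinuousMap.snd).restrict (U i))) :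
    ∃ Φ : C(S n × S n, Fin N → ℂ), (∀ p, ∃ i, Φ p i ≠ 0) ∧
      ∀ (p q : S n × S n) (l μ : ℂ), ‖l‖ = 1 → ‖μ‖ = 1 → q.1.1 = l • p.1.1 → q.2.1 = μ • p.2.1 →
        ∀ i, Φ q i = l ^ d * μ ^ (-d) * Φ p i := by
  obtain ⟨ρ, hρ⟩ := PartitionOfUnity.exists_isSubordinate isClosed_univ U hUo hUc.ge
  choose Fi h1 h2 using fun i => local_sec f F d hF1 hF2 hF3 (U i) (hU i) (ρ i) (hρ i)
  refine ⟨⟨fun p i => if h : (i : ℕ) < k then Fi ⟨i, h⟩ p else 0, ?_⟩, ?_, ?_⟩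
  · refine continuous_pi fun i => ?_
    split_ifs
    · fun_prop
    · fun_prop
  · intro p
    obtain ⟨i, hi⟩ := ρ.exists_pos (Set.mem_univ (sm2 p))
    refine ⟨⟨i, i.2.trans_le hk⟩, ?_⟩
    simp only [ContinuousMap.coe_mk, i.2, dif_pos]
    exact h1 i p hi.ne'
  · intro p q l μ hl hμ e1 e2 i
    simp only [ContinuousMap.coe_mk]
    split_ifs with h
    · exact h2 _ p q l μ hl hμ e1 e2
    · simp

end TCP
end

section
open scoped LinearAlgebra.Projectivization
namespace TCP

noncomputable def ee (r : ℝ) : ℂ := Complex.exp (2 * Real.pi * (r : ℝ) * Complex.I)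

theorem ee_add (r s : ℝ) : ee (r + s) = ee r * ee s := by
  unfold ee; rw [← Complex.exp_add]; congr 1; push_cast; ring

theorem ee_zero : ee 0 = 1 := by simp [ee]

theorem ee_int (k : ℤ) : ee k = 1 := by
  unfold ee
  rw [Complex.exp_eq_one_iff]
  exact ⟨k, by push_cast; ring⟩

theorem norm_ee (r : ℝ) : ‖ee r‖ = 1 := by
  unfold ee
  have : (2 * Real.pi * (r : ℝ) * Complex.I : ℂ) = ((2 * Real.pi * r : ℝ) : ℂ) * Complex.I := by
    push_cast; ring
  rw [this, Complex.norm_exp_ofReal_mul_I]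

theorem ee_ne (r : ℝ) : ee r ≠ 0 := Complex.exp_ne_zero _

theorem ee_zpow (r : ℝ) (d : ℤ) : ee r ^ d = ee (d * r) := by
  unfold ee; rw [← Complex.exp_int_mul]; congr 1; push_cast; ring

@[fun_prop]
theorem continuous_ee : Continuous ee := by unfold ee; fun_prop

noncomputable def Lf (g : ℝ → ℝ → ℂ) (x y : ℝ) : ℂ := ee ((x - Int.fract x) * y) * g y (Int.fract x)

theorem Lf_x (g : ℝ → ℝ → ℂ) (x y : ℝ) : Lf g (x + 1) y = ee y * Lf g x y := by
  unfold Lf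
  rw [Int.fract_add_one, ← mul_assoc, ← ee_add]
  congr 2; ring

theorem Lf_y (g : ℝ → ℝ → ℂ) (hg : ∀ y t, g (y + 1) t = g y t) (x y : ℝ) : Lf g x (y + 1) = Lf g x y := by
  unfold Lf
  rw [hg, mul_add, ee_add, mul_one]
  have : x - Int.fract x = (⌊x⌋ : ℤ) := by rw [Int.self_sub_fract]
  rw [this, ee_int, mul_one]

theorem continuous_Lf (g : ℝ → ℝ → ℂ) (hg : Continuous (Function.uncurry g))
    (h01 : ∀ y, g y 0 = ee (- y) * g y 1) : Continuous fun q : ℝ × ℝ => Lf g q.1 q.2 := by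
  have := ContinuousOn.comp_fract (s := fun q : ℝ × ℝ => q.1)
    (f := fun q t => ee (q.1 * q.2 - t * q.2) * g q.2 t) ?_ continuous_fst ?_
  · refine this.congr fun q => ?_
    simp only [Lf, sub_mul]
  · refine Continuous.continuousOn ?_
    have : Continuous fun q : (ℝ × ℝ) × ℝ => g q.1.2 q.2 := hg.comp (by fun_prop : Continuous fun q : (ℝ × ℝ) × ℝ => (q.1.2, q.2))
    simp only [Function.uncurry_def]
    fun_prop
  · intro q
    rw [h01, ← mul_assoc, ← ee_add]; congr 2; ring

noncomputable def g1 (y t : ℝ) : ℂ := (1 - (t : ℂ)) + t * ee y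
noncomputable def g2 (_ t : ℝ) : ℂ := (t : ℂ) * (1 - t)

theorem Lf_ne (x y : ℝ) : ¬ (Lf g1 x y = 0 ∧ Lf g2 x y = 0) := by
  rintro ⟨h1, h2⟩
  simp only [Lf, mul_eq_zero, ee_ne, false_or, g1, g2] at h1 h2
  have hlt := Int.fract_lt_one x
  rcases h2 with h | h
  · rw [h] at h1; simp at h1
  · have : (1 - Int.fract x : ℝ) = 0 := by exact_mod_cast h
    linarith

theorem cg1 : Continuous fun q : ℝ × ℝ => Lf g1 q.1 q.2 := by
  refine continuous_Lf _ ?_ ?_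
  · simp only [Function.uncurry_def, g1]; fun_prop
  · intro y
    simp only [g1]
    simp [← ee_add, ee_zero]

theorem cg2 : Continuous fun q : ℝ × ℝ => Lf g2 q.1 q.2 := by
  refine continuous_Lf _ ?_ ?_
  · simp only [Function.uncurry_def, g2]; fun_prop
  · intro y; simp [g2]

theorem g1y (y t : ℝ) : g1 (y + 1) t = g1 y t := by
  have := ee_int 1
  simp only [Int.cast_one] at this
  simp [g1, ee_add, this]

open Polynomial in
noncomputable def Pol {n : ℕ} (s : Finset (Fin n)) (A B : Fin n → ℂ) : ℂ[X] := ∏ k ∈ s, (C (A k) + C (B k) * X)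

theorem Pol_cont {X : Type*} [TopologicalSpace X] {n : ℕ} (A B : X → Fin n → ℂ) (hA : Continuous A) (hB : Continuous B)
    (s : Finset (Fin n)) : ∀ j, Continuous fun x => (Pol s (A x) (B x)).coeff j := by
  induction s using Finset.induction_on with
  | empty => intro j; simp only [Pol, Finset.prod_empty]; exact continuous_const
  | insert k s hk ih =>
    intro j
    have hAk : Continuous fun x => A x k := by fun_prop
    have hBk : Continuous fun x => B x k := by fun_prop
    have : ∀ x, Pol (insert k s) (A x) (B x) = (Polynomial.C (A x k) + Polynomial.C (B x k) * Polynomial.X) * Pol s (A x) (B x) :=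
      fun x => Finset.prod_insert hk
    simp only [this, add_mul, Polynomial.coeff_add, mul_assoc, Polynomial.coeff_C_mul]
    cases j with
    | zero =>
      simp only [Polynomial.coeff_X_mul_zero, mul_zero, add_zero]
      exact hAk.mul (ih 0)
    | succ j =>
      simp only [Polynomial.coeff_X_mul]
      exact (hAk.mul (ih _)).add (hBk.mul (ih _))

theorem Pol_ne {n : ℕ} (s : Finset (Fin n)) (A B : Fin n → ℂ) (h : ∀ k, ¬ (A k = 0 ∧ B k = 0)) : Pol s A B ≠ 0 := by
  unfold Pol
  rw [Finset.prod_ne_zero_iff]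
  intro k _ h0
  refine h k ⟨?_, ?_⟩
  · have := congrArg (fun p => Polynomial.coeff p 0) h0
    simpa using this
  · have := congrArg (fun p => Polynomial.coeff p 1) h0
    simpa [Polynomial.coeff_C] using this

theorem Pol_deg {n : ℕ} (A B : Fin n → ℂ) : (Pol Finset.univ A B).natDegree ≤ n := by
  unfold Pol
  refine (Polynomial.natDegree_prod_le _ _).trans ?_
  calc _ ≤ ∑ k : Fin n, 1 := Finset.sum_le_sum fun k _ => by compute_degree
    _ = n := by simp

theorem Pol_scale {n : ℕ} (A B c : Fin n → ℂ) :
    Pol Finset.univ (fun k => c k * A k) (fun k => c k * B k) = Polynomial.C (∏ k, c k) * Pol Finset.univ A B := by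
  unfold Pol
  rw [map_prod, ← Finset.prod_mul_distrib]
  refine Finset.prod_congr rfl fun k _ => ?_
  simp only [map_mul]; ring

noncomputable def Z0 {n : ℕ} (q : (Fin n → ℝ) × (Fin n → ℝ)) : V n :=
  WithLp.toLp 2 fun j : Fin (n + 1) =>
    (Pol Finset.univ (fun k => Lf g1 (q.1 k) (q.2 k)) (fun k => Lf g2 (q.1 k) (q.2 k))).coeff j

theorem Z0_ne {n : ℕ} (q : (Fin n → ℝ) × (Fin n → ℝ)) : Z0 q ≠ 0 := by
  intro h
  refine Pol_ne Finset.univ _ _ (fun k => Lf_ne (q.1 k) (q.2 k)) ?_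
  ext j
  by_cases hj : j < n + 1
  · have := congrArg (fun v : V n => v ⟨j, hj⟩) h
    simpa [Z0] using this
  · rw [Polynomial.coeff_eq_zero_of_natDegree_lt]
    · simp
    · have := Pol_deg (fun k => Lf g1 (q.1 k) (q.2 k)) (fun k => Lf g2 (q.1 k) (q.2 k))
      omega

theorem continuous_Z0 (n : ℕ) : Continuous (Z0 : (Fin n → ℝ) × (Fin n → ℝ) → V n) := by
  have hc : ∀ k, Continuous fun q : (Fin n → ℝ) × (Fin n → ℝ) => (q.1 k, q.2 k) := fun k =>
    ((continuous_apply k).comp continuous_fst).prodMk ((continuous_apply k).comp continuous_snd)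
  have hA : Continuous fun q : (Fin n → ℝ) × (Fin n → ℝ) => fun k => Lf g1 (q.1 k) (q.2 k) :=
    continuous_pi fun k => by
      have := cg1.comp (hc k)
      simpa only [Function.comp_def] using this
  have hB : Continuous fun q : (Fin n → ℝ) × (Fin n → ℝ) => fun k => Lf g2 (q.1 k) (q.2 k) :=
    continuous_pi fun k => by
      have := cg2.comp (hc k)
      simpa only [Function.comp_def] using this
  have h : Continuous fun q : (Fin n → ℝ) × (Fin n → ℝ) => fun j : Fin (n + 1) =>
    (Pol Finset.univ (fun k => Lf g1 (q.1 k) (q.2 k)) (fun k => Lf g2 (q.1 k) (q.2 k))).coeff j :=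
    continuous_pi fun j => Pol_cont _ _ hA hB Finset.univ j
  exact (PiLp.continuous_toLp 2 (fun _ : Fin (n + 1) => ℂ)).comp h

theorem Z0_x {n : ℕ} (x y : Fin n → ℝ) (k : Fin n) : Z0 (x + Pi.single k 1, y) = ee (y k) • Z0 (x, y) := by
  have key : ∀ (g : ℝ → ℝ → ℂ) (i : Fin n), Lf g ((x + Pi.single k 1 : Fin n → ℝ) i) (y i) = (if i = k then ee (y k) else 1) * Lf g (x i) (y i) := by
    intro g i
    split_ifs with h
    · subst h; simp [Lf_x]
    · simp [h]
  ext j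
  simp only [Z0, key, PiLp.smul_apply, smul_eq_mul]
  rw [Pol_scale, Polynomial.coeff_C_mul]
  simp

theorem Z0_y {n : ℕ} (x y : Fin n → ℝ) (k : Fin n) : Z0 (x, y + Pi.single k 1) = Z0 (x, y) := by
  have key : ∀ (g : ℝ → ℝ → ℂ) (hg : ∀ y t, g (y + 1) t = g y t) (i : Fin n), Lf g (x i) ((y + Pi.single k 1 : Fin n → ℝ) i) = Lf g (x i) (y i) := by
    intro g hg i
    by_cases h : i = k
    · subst h; simp [Lf_y g hg]
    · simp [h]
  ext j
  simp only [Z0, key g1 g1y, key g2 (fun _ _ => rfl)]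

noncomputable def Zs {n : ℕ} (q : (Fin n → ℝ) × (Fin n → ℝ)) : S n :=
  ⟨((‖Z0 q‖⁻¹ : ℝ) : ℂ) • Z0 q, by
    rw [mem_sphere_zero_iff_norm, norm_smul]
    simp [norm_ne_zero_iff.2 (Z0_ne q)]⟩

theorem continuous_Zs (n : ℕ) : Continuous (Zs : (Fin n → ℝ) × (Fin n → ℝ) → S n) := by
  refine Continuous.subtype_mk ?_ _
  have h : Continuous fun q : (Fin n → ℝ) × (Fin n → ℝ) => ((‖Z0 q‖⁻¹ : ℝ) : ℂ) :=
    Complex.continuous_ofReal.comp ((continuous_Z0 n).norm.inv₀ fun q => norm_ne_zero_iff.2 (Z0_ne q))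
  exact h.smul (continuous_Z0 n)

theorem Zs_x {n : ℕ} (x y : Fin n → ℝ) (k : Fin n) : (Zs (x + Pi.single k 1, y)).1 = ee (y k) • (Zs (x, y)).1 := by
  simp only [Zs, Z0_x, norm_smul, norm_ee, one_mul]
  rw [smul_comm]

theorem Zs_y {n : ℕ} (x y : Fin n → ℝ) (k : Fin n) : Zs (x, y + Pi.single k 1) = Zs (x, y) := by
  simp only [Zs, Z0_y]

theorem no_section {n : ℕ} (d : ℤ) (hd : d ≠ 0) (Φ : C(S n × S n, Fin (n + n) → ℂ)) (h1 : ∀ p, ∃ i, Φ p i ≠ 0)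
    (h2 : ∀ (p q : S n × S n) (l μ : ℂ), ‖l‖ = 1 → ‖μ‖ = 1 → q.1.1 = l • p.1.1 → q.2.1 = μ • p.2.1 →
        ∀ i, Φ q i = l ^ d * μ ^ (-d) * Φ p i) : False := by
  let z : (Fin ((n + n) * 2) → ℝ) → S n := fun p =>
    Zs (fun k => p (ev (Fin.castAdd n k)), fun k => p (od (Fin.castAdd n k)))
  let w : (Fin ((n + n) * 2) → ℝ) → S n := fun p =>
    Zs (fun k => p (ev (Fin.natAdd n k)), fun k => - p (od (Fin.natAdd n k)))
  have hz : Continuous z := (continuous_Zs n).comp (by fun_prop)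
  have hw : Continuous w := (continuous_Zs n).comp (by fun_prop)
  have evev : ∀ i j : Fin (n + n), ev i = ev j ↔ i = j := fun i j => ⟨fun h => ev_inj h, fun h => h ▸ rfl⟩
  have odod : ∀ i j : Fin (n + n), od i = od j ↔ i = j := fun i j => by simp [od]
  have evod : ∀ i j : Fin (n + n), ev i ≠ od j := fun i j => ev_ne_od i j
  have odev : ∀ i j : Fin (n + n), od i ≠ ev j := fun i j => (ev_ne_od j i).symm
  have cn : ∀ i j : Fin n, Fin.castAdd n i ≠ Fin.natAdd n j := fun i j h => by
    have := congrArg Fin.val h; simp at this; omega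
  have nc : ∀ i j : Fin n, Fin.natAdd n i ≠ Fin.castAdd n j := fun i j h => cn _ _ h.symm
  refine torus_key (n + n) d hd (fun p => Φ (z p, w p)) (Φ.continuous.comp (hz.prodMk hw)) (fun p => h1 _) ?_ ?_
  · intro p k i
    change _ = ee (d * p (od k)) * _
    induction k using Fin.addCases with
    | left k =>
      have a1 : (z (p + Pi.single (ev (Fin.castAdd n k)) 1)).1 = ee (p (od (Fin.castAdd n k))) • (z p).1 := by
        rw [← Zs_x (fun k => p (ev (Fin.castAdd n k))) (fun k => p (od (Fin.castAdd n k))) k]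
        simp only [z]
        congr 3
        · funext j; simp [Pi.single_apply, evev]
        · funext j; simp [Pi.single_apply, odev]
      have a2 : (w (p + Pi.single (ev (Fin.castAdd n k)) 1)).1 = (1 : ℂ) • (w p).1 := by
        rw [one_smul]
        simp only [w]
        congr 3
        · funext j; simp [Pi.single_apply, evev, nc, -Fin.natAdd_eq_addNat]
        · funext j; simp [Pi.single_apply, odev]
      have := h2 (z p, w p) (z (p + Pi.single (ev (Fin.castAdd n k)) 1), w (p + Pi.single (ev (Fin.castAdd n k)) 1)) _ _
        (norm_ee _) norm_one a1 a2 i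
      rw [this, one_zpow, mul_one, ee_zpow]
    | right k =>
      have a1 : (w (p + Pi.single (ev (Fin.natAdd n k)) 1)).1 = ee (- p (od (Fin.natAdd n k))) • (w p).1 := by
        rw [← Zs_x (fun k => p (ev (Fin.natAdd n k))) (fun k => - p (od (Fin.natAdd n k))) k]
        simp only [w]
        congr 3
        · funext j; simp [Pi.single_apply, evev]
        · funext j; simp [Pi.single_apply, odev]
      have a2 : (z (p + Pi.single (ev (Fin.natAdd n k)) 1)).1 = (1 : ℂ) • (z p).1 := by
        rw [one_smul]
        simp only [z]
        congr 3
        · funext j; simp [Pi.single_apply, evev, cn, -Fin.natAdd_eq_addNat]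
        · funext j; simp [Pi.single_apply, odev]
      have := h2 (z p, w p) (z (p + Pi.single (ev (Fin.natAdd n k)) 1), w (p + Pi.single (ev (Fin.natAdd n k)) 1)) _ _
        norm_one (norm_ee _) a2 a1 i
      rw [this, one_zpow, one_mul, ee_zpow]
      congr 2; push_cast; ring
  · intro p k i
    have ez : z (p + Pi.single (od k) 1) = z p := by
      induction k using Fin.addCases with
      | left k =>
        simp only [z]
        rw [← Zs_y (fun k => p (ev (Fin.castAdd n k))) (fun k => p (od (Fin.castAdd n k))) k]
        congr 2
        · funext j; simp [Pi.single_apply, evod]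
        · funext j; simp [Pi.single_apply, odod]
      | right k =>
        simp only [z]
        congr 2
        · funext j; simp [Pi.single_apply, evod]
        · funext j; simp [Pi.single_apply, odod, cn, -Fin.natAdd_eq_addNat]
    have ew : w (p + Pi.single (od k) 1) = w p := by
      induction k using Fin.addCases with
      | left k =>
        simp only [w]
        congr 2
        · funext j; simp [Pi.single_apply, evod]
        · funext j; simp [Pi.single_apply, odod, nc, -Fin.natAdd_eq_addNat]
      | right k =>
        simp only [w]
        refine Eq.trans (Zs_y _ _ k).symm ?_
        congr 2
        · funext j; simp [Pi.single_apply, evod]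
        · funext j; simp [Pi.single_apply, odod]
    simp only [ez, ew]

theorem lower {n m : ℕ} (hn : 1 ≤ n) (hnm : n ≤ m) (f : C(CP n, CP m)) (hf : ¬ f.Nullhomotopic)
    (k : ℕ) (hk : k ≤ n + n) (U : Fin k → Set (CP n × CP n)) (hUo : ∀ i, IsOpen (U i)) (hUc : ⋃ i, U i = Set.univ)
    (hU : ∀ i, ((f.comp ContinuousMap.fst).restrict (U i)).Homotopic ((f.comp ContinuousMap.snd).restrict (U i))) : False := by
  obtain ⟨d, F, hF1, hF2, hF3⟩ := degree_lift hn f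
  by_cases hd : d = 0
  · subst hd
    exact hf (null_of_zero hnm f F hF1 hF2 fun z w l hl h => by simpa using hF3 z w l hl h)
  · obtain ⟨Φ, h1, h2⟩ := global_sec f F d hF1 hF2 hF3 k (n + n) hk U hUo hUc hU
    exact no_section d hd Φ h1 h2

end TCP
end

section
open scoped LinearAlgebra.Projectivization
namespace TCP

theorem red_lower {X Y : Type} [TopologicalSpace X] [TopologicalSpace Y] (f : C(X, Y)) (U : Set (X × X))
    (h : IsFCatOpen (pathFib X) (f.prodMap f) U) :
    ((f.comp ContinuousMap.fst).restrict U).Homotopic ((f.comp ContinuousMap.snd).restrict U) := by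
  obtain ⟨-, s, hs⟩ := h
  have h1 := (ContinuousMap.Homotopic.refl (ContinuousMap.fst : C(Y × Y, Y))).comp hs
  have h2 := (ContinuousMap.Homotopic.refl (ContinuousMap.snd : C(Y × Y, Y))).comp hs
  refine h1.symm.trans (ContinuousMap.Homotopic.trans ?_ h2)
  refine ⟨⟨⟨fun q => f (s q.2 q.1), ?_⟩, ?_, ?_⟩⟩
  · fun_prop
  · intro x; rfl
  · intro x; rfl

theorem red_upper {X Y : Type} [TopologicalSpace X] [TopologicalSpace Y] (f : C(X, Y)) (U : Set (X × X))
    (hUo : IsOpen U)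
    (h : ((ContinuousMap.fst : C(X × X, X)).restrict U).Homotopic ((ContinuousMap.snd : C(X × X, X)).restrict U)) :
    IsFCatOpen (pathFib X) (f.prodMap f) U := by
  obtain ⟨H⟩ := h
  refine ⟨hUo, (H.toContinuousMap.comp ContinuousMap.prodSwap).curry, ?_⟩
  have : ((f.prodMap f).comp (pathFib X)).comp (H.toContinuousMap.comp ContinuousMap.prodSwap).curry
      = (f.prodMap f).restrict U := by
    ext x
    · change f (H (0, x)) = _
      rw [H.apply_zero]; rfl
    · change f (H (1, x)) = _
      rw [H.apply_one]; rfl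
  rw [this]


noncomputable def eb {n : ℕ} (i : Fin (n + 1)) : V n := EuclideanSpace.single i 1

theorem eb_ne {n : ℕ} (i : Fin (n + 1)) : eb i ≠ 0 := by
  intro h
  have := congrArg (fun v : V n => v i) h
  simp [eb] at this

noncomputable def eC {Y : Type} [TopologicalSpace Y] {n : ℕ} (i : Y → Fin (n + 1)) (hi : IsLocallyConstant i) : C(Y, V n) :=
  ⟨fun y => eb (i y), (hi.comp eb).continuous⟩

theorem hom_to_const {Y : Type} [TopologicalSpace Y] {n : ℕ} (g : C(Y, CP n)) (i : Y → Fin (n + 1)) (hi : IsLocallyConstant i)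
    (h : ∀ y, pr (g y) (eb (i y)) ≠ 0) : g.Homotopic (mkC (eC i hi) (fun _ => eb_ne _)) := by
  have hc : Continuous fun y => pr (g y) (eb (i y)) :=
    ((continuous_pr n).comp g.continuous).clm_apply (eC i hi).continuous
  have e : g = mkC ⟨fun y => pr (g y) (eb (i y)), hc⟩ h := by
    ext y
    exact (mk_eq_of_pr (g y) _ (h y) (pr_idem _ _)).symm
  have := mkC_homotopic ⟨fun y => pr (g y) (eb (i y)), hc⟩ (eC i hi) h (fun _ => eb_ne _) (by
    intro y s t _ _ hst h0
    refine h y ?_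
    have h1 := congrArg (pr (g y)) h0
    simp only [eC, ContinuousMap.coe_mk] at h1
    rw [map_add, map_zero, ← Complex.coe_smul s, ← Complex.coe_smul t, map_smul, map_smul, pr_idem, ← add_smul,
      ← Complex.ofReal_add, hst, Complex.ofReal_one, one_smul] at h1
    exact h1)
  rw [← e] at this
  exact this

theorem hom_const {Y : Type} [TopologicalSpace Y] {n : ℕ} (i j : Y → Fin (n + 1)) (hi : IsLocallyConstant i) (hj : IsLocallyConstant j) :
    (mkC (eC i hi) (fun _ => eb_ne _)).Homotopic (mkC (eC j hj) (fun _ => eb_ne _)) := by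
  refine mkC_homotopic _ _ _ _ ?_
  intro y s t _ _ hst h0
  have h1 := congrArg (fun v : V n => v (i y)) h0
  have h2 := congrArg (fun v : V n => v (j y)) h0
  simp only [eC, eb, ContinuousMap.coe_mk] at h1 h2
  by_cases hij : i y = j y
  · rw [hij] at h1
    simp at h1
    rw [← Complex.ofReal_add, hst] at h1
    simp at h1
  · have hji : ¬ j y = i y := fun h => hij h.symm
    simp [hij, hji] at h1 h2
    rw [h1, h2] at hst; simp at hst

theorem exists_pr_ne {n : ℕ} (x : CP n) : ∃ i : Fin (n + 1), pr x (eb i) ≠ 0 := by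
  by_contra! h
  have h0 : pr x = 0 := by
    ext1 v
    have : v = ∑ i, v i • eb i := by
      ext j
      simp [eb, Pi.single_apply]
    rw [this, map_sum]
    simp [h]
  induction x using Projectivization.ind with
  | h u hu =>
    have := pr_mk_self u hu
    rw [h0] at this
    exact hu (by simpa using this.symm)

noncomputable def ph {n : ℕ} (i : Fin (n + 1)) (x : CP n) : ℝ := ‖pr x (eb i)‖

theorem continuous_ph {n : ℕ} (i : Fin (n + 1)) : Continuous (ph i : CP n → ℝ) :=
  ((continuous_pr n).clm_apply continuous_const).norm

noncomputable def mx {n : ℕ} (x : CP n) : ℝ := Finset.univ.sup' Finset.univ_nonempty fun i : Fin (n + 1) => ph i x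

theorem continuous_mx (n : ℕ) : Continuous (mx : CP n → ℝ) := by
  unfold mx
  exact Continuous.finset_sup'_apply _ fun i _ => continuous_ph i

theorem ph_le {n : ℕ} (i : Fin (n + 1)) (x : CP n) : ph i x ≤ mx x :=
  Finset.le_sup' (fun i : Fin (n + 1) => ph i x) (Finset.mem_univ i)

theorem exists_mx {n : ℕ} (x : CP n) : ∃ i, ph i x = mx x := by
  obtain ⟨i, -, hi⟩ := Finset.exists_mem_eq_sup' (Finset.univ_nonempty) fun i : Fin (n + 1) => ph i x
  exact ⟨i, hi.symm⟩

theorem mx_pos {n : ℕ} (x : CP n) : 0 < mx x := by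
  obtain ⟨i, hi⟩ := exists_pr_ne x
  exact (norm_pos_iff.2 hi).trans_le (ph_le i x)

noncomputable def vl {n : ℕ} (a : Fin (n + 1) ⊕ Fin (n + 1)) (x : CP n × CP n) : ℝ :=
  Sum.elim (fun i => ph i x.1 * mx x.2) (fun j => ph j x.2 * mx x.1) a

theorem continuous_vl {n : ℕ} (a : Fin (n + 1) ⊕ Fin (n + 1)) : Continuous (vl a : CP n × CP n → ℝ) := by
  unfold vl
  cases a with
  | inl i => exact ((continuous_ph i).comp continuous_fst).mul ((continuous_mx n).comp continuous_snd)
  | inr i => exact ((continuous_ph i).comp continuous_snd).mul ((continuous_mx n).comp continuous_fst)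

def VA {n : ℕ} (A : Finset (Fin (n + 1) ⊕ Fin (n + 1))) : Set (CP n × CP n) :=
  {x | (∀ a ∈ A, ∀ b ∉ A, vl b x < vl a x) ∧ (∀ a ∈ A, 0 < vl a x) ∧ (∃ i, Sum.inl i ∈ A) ∧ ∃ j, Sum.inr j ∈ A}

theorem isOpen_VA {n : ℕ} (A : Finset (Fin (n + 1) ⊕ Fin (n + 1))) : IsOpen (VA A) := by
  have h1 : IsOpen {x : CP n × CP n | ∀ a ∈ A, ∀ b ∉ A, vl b x < vl a x} := by
    simp only [Set.ofPred_forall]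
    refine isOpen_iInter_of_finite fun a => isOpen_iInter_of_finite fun _ => isOpen_iInter_of_finite fun b =>
      isOpen_iInter_of_finite fun _ => isOpen_lt (continuous_vl b) (continuous_vl a)
  have h2 : IsOpen {x : CP n × CP n | ∀ a ∈ A, 0 < vl a x} := by
    simp only [Set.ofPred_forall]
    refine isOpen_iInter_of_finite fun a => isOpen_iInter_of_finite fun _ => isOpen_lt continuous_const (continuous_vl a)
  exact h1.inter (h2.inter isOpen_const)

theorem VA_uniq {n : ℕ} (A B : Finset (Fin (n + 1) ⊕ Fin (n + 1))) (hc : A.card = B.card) (x : CP n × CP n)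
    (hA : x ∈ VA A) (hB : x ∈ VA B) : A = B := by
  by_contra hne
  have h1 : ¬ A ⊆ B := fun h => hne (Finset.eq_of_subset_of_card_le h hc.ge)
  have h2 : ¬ B ⊆ A := fun h => hne (Finset.eq_of_subset_of_card_le h hc.le).symm
  obtain ⟨a, ha, ha'⟩ := Finset.not_subset.1 h1
  obtain ⟨b, hb, hb'⟩ := Finset.not_subset.1 h2
  exact lt_asymm (hA.1 a ha b hb') (hB.1 b hb a ha')

def Wk (n k : ℕ) : Set (CP n × CP n) := {x | ∃ A, A.card = k + 2 ∧ x ∈ VA A}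

theorem isOpen_Wk (n k : ℕ) : IsOpen (Wk n k) := by
  have : Wk n k = ⋃ A : {A : Finset (Fin (n + 1) ⊕ Fin (n + 1)) // A.card = k + 2}, VA A.1 := by
    ext x; simp [Wk]
  rw [this]
  exact isOpen_iUnion fun A => isOpen_VA _

theorem Wk_hom (n k : ℕ) : ((ContinuousMap.fst : C(CP n × CP n, CP n)).restrict (Wk n k)).Homotopic
    ((ContinuousMap.snd : C(CP n × CP n, CP n)).restrict (Wk n k)) := by
  choose ch h1 h2 using fun x : Wk n k => x.2
  have hlc : IsLocallyConstant ch := by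
    rw [IsLocallyConstant.iff_exists_open]
    intro x
    refine ⟨Subtype.val ⁻¹' VA (ch x), (isOpen_VA _).preimage continuous_subtype_val, h2 x, fun y hy => ?_⟩
    exact VA_uniq _ _ ((h1 y).trans (h1 x).symm) y.1 (h2 y) hy
  classical
  let gi : Finset (Fin (n + 1) ⊕ Fin (n + 1)) → Fin (n + 1) := fun A => if h : ∃ i, Sum.inl i ∈ A then h.choose else 0
  let gj : Finset (Fin (n + 1) ⊕ Fin (n + 1)) → Fin (n + 1) := fun A => if h : ∃ i, Sum.inr i ∈ A then h.choose else 0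
  have hgi : ∀ A, (∃ i, Sum.inl i ∈ A) → Sum.inl (gi A) ∈ A := fun A h => by
    simp only [gi, dif_pos h]; exact h.choose_spec
  have hgj : ∀ A, (∃ i, Sum.inr i ∈ A) → Sum.inr (gj A) ∈ A := fun A h => by
    simp only [gj, dif_pos h]; exact h.choose_spec
  refine (hom_to_const _ (fun x => gi (ch x)) (hlc.comp gi) ?_).trans ((hom_const _ (fun x => gj (ch x)) _ (hlc.comp gj)).trans
    (hom_to_const _ (fun x => gj (ch x)) (hlc.comp gj) ?_).symm)
  · intro x
    have := (h2 x).2.1 _ (hgi _ (h2 x).2.2.1)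
    simp only [vl, Sum.elim_inl] at this
    exact norm_pos_iff.1 (pos_of_mul_pos_left this (mx_pos _).le)
  · intro x
    have := (h2 x).2.1 _ (hgj _ (h2 x).2.2.2)
    simp only [vl, Sum.elim_inr] at this
    exact norm_pos_iff.1 (pos_of_mul_pos_left this (mx_pos _).le)

theorem Wk_cover (n : ℕ) : ⋃ k : Fin (2 * n + 1), Wk n k = Set.univ := by
  classical
  rw [Set.eq_univ_iff_forall]
  intro x
  have hp : 0 < mx x.1 * mx x.2 := mul_pos (mx_pos _) (mx_pos _)
  let A : Finset (Fin (n + 1) ⊕ Fin (n + 1)) := Finset.univ.filter fun a => vl a x = mx x.1 * mx x.2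
  have hA : ∀ a, a ∈ A ↔ vl a x = mx x.1 * mx x.2 := fun a => by simp [A]
  obtain ⟨i, hi⟩ := exists_mx x.1
  obtain ⟨j, hj⟩ := exists_mx x.2
  have hiA : Sum.inl i ∈ A := by rw [hA]; simp [vl, hi]
  have hjA : Sum.inr j ∈ A := by rw [hA]; simp [vl, hj, mul_comm]
  have hle : ∀ a, vl a x ≤ mx x.1 * mx x.2 := by
    rintro (a | a)
    · exact mul_le_mul_of_nonneg_right (ph_le _ _) (mx_pos _).le
    · rw [mul_comm]; exact mul_le_mul_of_nonneg_right (ph_le _ _) (mx_pos _).le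
  have hc2 : 2 ≤ A.card := by
    rw [← Finset.card_pair (Sum.inl_ne_inr : Sum.inl i ≠ Sum.inr j)]
    refine Finset.card_le_card ?_
    intro a ha
    simp only [Finset.mem_insert, Finset.mem_singleton] at ha
    rcases ha with rfl | rfl
    · exact hiA
    · exact hjA
  have hc3 : A.card ≤ 2 * n + 2 := by
    refine (Finset.card_le_univ A).trans ?_
    simp; omega
  rw [Set.mem_iUnion]
  refine ⟨⟨A.card - 2, by omega⟩, A, by simp only; omega, ?_, ?_, ⟨i, hiA⟩, ⟨j, hjA⟩⟩
  · intro a ha b hb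
    rw [hA] at ha hb
    rw [ha]; exact lt_of_le_of_ne (hle b) hb
  · intro a ha
    rw [hA] at ha; rw [ha]; exact hp

theorem final {n m : ℕ} (hn : 1 ≤ n) (hnm : n ≤ m) (f : C(CP n, CP m)) (hf : ¬ f.Nullhomotopic) :
    TCmap f = 2 * n := by
  refine le_antisymm ?_ ?_
  · refine sInf_le ⟨2 * n, ⟨fun k => Wk n k, fun k => red_upper f _ (isOpen_Wk n k) (Wk_hom n k), Wk_cover n⟩, ?_⟩
    push_cast; rfl
  · refine le_sInf ?_
    rintro _ ⟨k, ⟨U, hU, hc⟩, rfl⟩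
    by_contra hlt
    have hk : k + 1 ≤ n + n := by
      have : ¬ (2 * n ≤ k) := fun h => hlt (by exact_mod_cast h)
      omega
    exact lower hn hnm f hf (k + 1) hk U (fun i => (hU i).1) hc fun i => red_lower f _ (hU i)

end TCP
end

/-- for `f : ℂPⁿ → ℂPᵐ` (`1 ≤ n ≤ m`) of nonzero degree, `TC(f) = 2n`.
(Maps `ℂPⁿ → ℂPᵐ` are classified by their degree on `H²`, and such a map has nonzero
degree precisely when it is essential.) -/
theorem TCmap_cp (n m : ℕ) (hn : 1 ≤ n) (hnm : n ≤ m)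
    (f : C((ℙ ℂ (EuclideanSpace ℂ (Fin (n + 1)))), (ℙ ℂ (EuclideanSpace ℂ (Fin (m + 1))))))
    (hf : ¬ f.Nullhomotopic) :
    TCmap f = 2 * n := by
  exact TCP.final hn hnm f hf
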